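/- arXiv:1411.1486 — 8 statements merged into one kernel-verified Lean document; each statement's English description precedes it below -/
import Mathlib

section
/- Suppose for some integer τ ≥ 1 there exist symmetric positive definite matrices P_i ∈ ℝ^{n×n}, i ∈ {1,…,N}, such that (F_i(x))ᵀ P_i F_i(x) − xᵀ P_i x < 0 for all x ≠ 0 and all i ∈ {1,…,N}, and (F_i^τ(x))ᵀ P_j F_i^τ(x) < xᵀ P_i x for all x ≠ 0 and all pairs i ≠ j in {1,…,N}. Then the equilibrium x = 0 of the saturated switched system x(t+1) = F_{σ(t)}(x(t)) is globally asymptotically stable with dwell-time τ: for every ε > 0 there exists δ > 0 such that every trajectory under any DT-admissible switching signal with dwell-time τ starting with ‖x(0)‖ ≤ δ satisfies ‖x(t)‖ ≤ ε for all t, and every trajectory under any DT-admissible switching signal with dwell-time τ converges to 0 as t → ∞. -/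
open Matrix Filter

/-- Componentwise saturation: `sat(u)_j = sign(u_j) * min 1 |u_j|`. -/
noncomputable def satur {m : ℕ} (u : Fin m → ℝ) : Fin m → ℝ :=
  fun j => Real.sign (u j) * min 1 |u j|

/-- The closed-loop saturated map of mode `i`: `F_i(x) = A_i x + B_i sat(K_i x)`. -/
noncomputable def Fmode {n m N : ℕ} (A : Fin N → Matrix (Fin n) (Fin n) ℝ)
    (B : Fin N → Matrix (Fin n) (Fin m) ℝ) (K : Fin N → Matrix (Fin m) (Fin n) ℝ)
    (i : Fin N) (x : Fin n → ℝ) : Fin n → ℝ :=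
  (A i).mulVec x + (B i).mulVec (satur ((K i).mulVec x))

/-- A switching signal is DT-admissible with dwell-time `τ` : the first switch occurs
no earlier than time `τ`, and after any switch the signal stays constant for at
least `τ` steps. -/
def DTAdmissible {N : ℕ} (τ : ℕ) (σ : ℕ → Fin N) : Prop :=
  (∀ s < τ, σ s = σ 0) ∧ ∀ s, σ (s + 1) ≠ σ s → ∀ r < τ, σ (s + 1 + r) = σ (s + 1)

/-- `x : ℕ → ℝⁿ` is a trajectory of the switched system `x(t+1) = G_{σ(t)}(x(t))`. -/
def Traj {n N : ℕ} (G : Fin N → (Fin n → ℝ) → (Fin n → ℝ)) (σ : ℕ → Fin N)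
    (x : ℕ → Fin n → ℝ) : Prop :=
  ∀ t, x (t + 1) = G (σ t) (x t)

/-- Euclidean norm on `Fin n → ℝ`. -/
noncomputable def euclNorm {n : ℕ} (x : Fin n → ℝ) : ℝ :=
  Real.sqrt (∑ i, x i ^ 2)

theorem satur_cont {m : ℕ} : Continuous (satur (m := m)) := by
  have : (satur (m := m)) = fun u j => max (-1) (min 1 (u j)) := by
    funext u j
    unfold satur
    rcases lt_trichotomy (u j) 0 with h | h | h
    · rw [Real.sign_of_neg h, abs_of_neg h, min_eq_right (by linarith : u j ≤ 1)]
      rcases le_total 1 (-u j) with h' | h'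
      · rw [min_eq_left h', max_eq_left (by linarith)]; ring
      · rw [min_eq_right h', max_eq_right (by linarith)]; ring
    · simp [h]
    · rw [Real.sign_of_pos h, abs_of_pos h, one_mul, max_eq_right]
      exact le_min (by norm_num) (by linarith)
  rw [this]
  fun_prop

theorem satur_zero {m : ℕ} : satur (0 : Fin m → ℝ) = 0 := by
  funext j; simp [satur]

theorem Fmode_cont {n m N : ℕ} (A : Fin N → Matrix (Fin n) (Fin n) ℝ)
    (B : Fin N → Matrix (Fin n) (Fin m) ℝ) (K : Fin N → Matrix (Fin m) (Fin n) ℝ)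
    (i : Fin N) : Continuous (Fmode A B K i) := by
  unfold Fmode
  have h : Continuous fun x : Fin n → ℝ => satur ((K i).mulVec x) :=
    satur_cont.comp (by fun_prop)
  exact (by fun_prop : Continuous fun x => (A i).mulVec x).add
    (Continuous.matrix_mulVec continuous_const h)

theorem Fmode_zero {n m N : ℕ} (A : Fin N → Matrix (Fin n) (Fin n) ℝ)
    (B : Fin N → Matrix (Fin n) (Fin m) ℝ) (K : Fin N → Matrix (Fin m) (Fin n) ℝ)
    (i : Fin N) : Fmode A B K i 0 = 0 := by
  simp [Fmode, satur_zero]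

theorem quad_cont {n : ℕ} (P : Matrix (Fin n) (Fin n) ℝ) :
    Continuous fun x : Fin n → ℝ => x ⬝ᵥ P.mulVec x := by fun_prop

theorem quad_lower {n : ℕ} (P : Matrix (Fin n) (Fin n) ℝ) (hP : P.PosDef) :
    ∃ a > (0 : ℝ), ∀ x : Fin n → ℝ, a * ‖x‖ ^ 2 ≤ x ⬝ᵥ P.mulVec x := by
  obtain ⟨a, ha, h⟩ := (isCompact_sphere (0 : Fin n → ℝ) 1).exists_forall_le'
    (quad_cont P).continuousOn (a := 0) (by
      intro b hb
      have hb0 : b ≠ 0 := by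
        rintro rfl
        simp at hb
      simpa using hP.dotProduct_mulVec_pos hb0)
  refine ⟨a, ha, fun x => ?_⟩
  by_cases hx : x = 0
  · simp [hx]
  have hn : 0 < ‖x‖ := norm_pos_iff.2 hx
  have := h (‖x‖⁻¹ • x) (by simp [norm_smul, hn.ne'])
  simp only [mulVec_smul, smul_dotProduct, dotProduct_smul, smul_eq_mul] at this
  have h3 : a * ‖x‖ ^ 2 ≤ (‖x‖⁻¹ * (‖x‖⁻¹ * (x ⬝ᵥ P.mulVec x))) * ‖x‖ ^ 2 := by gcongr
  calc _ ≤ _ := h3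
    _ = _ := by field_simp

theorem annulus {n : ℕ} (P Q : Matrix (Fin n) (Fin n) ℝ) (hP : P.PosDef)
    (G : (Fin n → ℝ) → (Fin n → ℝ)) (hG : Continuous G) (hG0 : G 0 = 0)
    (h : ∀ x, x ≠ 0 → G x ⬝ᵥ Q.mulVec (G x) < x ⬝ᵥ P.mulVec x)
    (c C : ℝ) (hc : 0 < c) :
    ∃ η > (0 : ℝ), ∀ x, x ⬝ᵥ P.mulVec x ≤ C →
      G x ⬝ᵥ Q.mulVec (G x) ≤ c ∨ G x ⬝ᵥ Q.mulVec (G x) ≤ x ⬝ᵥ P.mulVec x - η := by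
  obtain ⟨a, ha, hl⟩ := quad_lower P hP
  have hGQ : Continuous fun x => G x ⬝ᵥ Q.mulVec (G x) := (quad_cont Q).comp hG
  have hS : IsCompact ({x | x ⬝ᵥ P.mulVec x ≤ C} ∩ {x | c ≤ G x ⬝ᵥ Q.mulVec (G x)}) := by
    refine Metric.isCompact_of_isClosed_isBounded
      ((isClosed_le (quad_cont P) continuous_const).inter
        (isClosed_le continuous_const hGQ)) ?_
    refine (Metric.isBounded_closedBall (x := 0) (r := C / a + 1)).subset ?_
    rintro x ⟨hx, -⟩
    have h1 := (hl x).trans hx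
    rw [mem_closedBall_zero_iff]
    have h2 : ‖x‖ ^ 2 ≤ C / a := by rw [le_div_iff₀ ha]; linarith
    nlinarith [sq_nonneg (‖x‖ - 1), norm_nonneg x]
  obtain ⟨η, hη, hh⟩ := hS.exists_forall_le'
    ((quad_cont P).sub hGQ).continuousOn (a := 0) (by
      rintro x ⟨-, hx⟩
      have hx0 : x ≠ 0 := by
        rintro rfl
        simp [hG0] at hx
        linarith
      have := h x hx0
      exact sub_pos.2 this)
  refine ⟨η, hη, fun x hx => ?_⟩
  rcases le_total (G x ⬝ᵥ Q.mulVec (G x)) c with h' | h'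
  · exact Or.inl h'
  · have : η ≤ x ⬝ᵥ P.mulVec x - G x ⬝ᵥ Q.mulVec (G x) := hh x ⟨hx, h'⟩
    right
    linarith

theorem exists_common {ι : Type*} [Finite ι] (p : ι → ℝ → Prop)
    (hm : ∀ i η η', η' ≤ η → p i η → p i η') (h : ∀ i, ∃ η > (0 : ℝ), p i η) :
    ∃ η > (0 : ℝ), ∀ i, p i η := by
  choose f hf hp using h
  rcases isEmpty_or_nonempty ι with h' | h'
  · exact ⟨1, one_pos, fun i => h'.elim i⟩
  · obtain ⟨i, hi⟩ := Finite.exists_min f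
    exact ⟨f i, hf i, fun j => hm j _ _ (hi j) (hp j)⟩

theorem seq_bound (W : ℕ → ℝ) (τ : ℕ) (hτ : 1 ≤ τ) (h0 : ∀ t < τ, W t ≤ W 0)
    (h : ∀ t, W (t + τ) ≤ W (t + τ - 1) ∨ W (t + τ) ≤ W t) : ∀ t, W t ≤ W 0 := by
  intro t
  induction t using Nat.strong_induction_on with
  | _ t ih =>
    rcases lt_or_ge t τ with ht | ht
    · exact h0 t ht
    · obtain ⟨s, rfl⟩ := Nat.exists_eq_add_of_le' ht
      rcases h s with h | h
      · exact h.trans (ih _ (by omega))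
      · exact h.trans (ih _ (by omega))

theorem seq_conv (W : ℕ → ℝ) (τ : ℕ) (hτ : 1 ≤ τ) (c C η : ℝ) (hη : 0 < η)
    (hC : ∀ t, W t ≤ C)
    (h : ∀ t, W (t + τ) ≤ c ∨ W (t + τ) ≤ W (t + τ - 1) - η ∨ W (t + τ) ≤ W t - η) :
    ∃ T, ∀ t ≥ T, W t ≤ c := by
  have key : ∀ k : ℕ, ∀ t ≥ k * τ, W t ≤ c ∨ W t ≤ C - k * η := by
    intro k
    induction k with
    | zero => intro t _; right; simpa using hC t
    | succ k ih =>
      intro t ht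
      have e : (k + 1) * τ = k * τ + τ := by ring
      obtain ⟨s, rfl⟩ := Nat.exists_eq_add_of_le' (show τ ≤ t by omega)
      push_cast
      rcases h s with h | h | h
      · exact Or.inl h
      · rcases ih (s + τ - 1) (by omega) with h' | h'
        · left; linarith
        · right; linarith
      · rcases ih s (by omega) with h' | h'
        · left; linarith
        · right; linarith
  obtain ⟨k, hk⟩ := exists_nat_gt ((C - c) / η)
  rw [div_lt_iff₀ hη] at hk
  refine ⟨k * τ, fun t ht => ?_⟩
  rcases key k t ht with h | h <;> linarith

theorem traj_const {n N : ℕ} (G : Fin N → (Fin n → ℝ) → (Fin n → ℝ)) (σ : ℕ → Fin N)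
    (x : ℕ → Fin n → ℝ) (hx : Traj G σ x) (t τ : ℕ) (h : ∀ r < τ, σ (t + r) = σ t) :
    x (t + τ) = (G (σ t))^[τ] (x t) := by
  induction τ with
  | zero => simp
  | succ k ih =>
    rw [Function.iterate_succ_apply', ← ih (fun r hr => h r (by omega)), ← add_assoc, hx,
      h k (by omega)]

theorem step_cases {N : ℕ} (τ : ℕ) (hτ : 1 ≤ τ) (σ : ℕ → Fin N) (hσ : DTAdmissible τ σ)
    (t : ℕ) : σ (t + τ) = σ (t + τ - 1) ∨
      (σ t ≠ σ (t + τ) ∧ ∀ r < τ, σ (t + r) = σ t) := by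
  by_cases hs : σ (t + τ) = σ (t + τ - 1)
  · exact Or.inl hs
  right
  have h1 : ∀ r, r + 1 < τ → σ (t + r + 1) = σ (t + r) := by
    intro r hr
    by_contra hne
    have h2 := hσ.2 (t + r) hne
    have h3 := h2 (τ - r - 1) (by omega)
    have h4 := h2 (τ - r - 2) (by omega)
    rw [show t + r + 1 + (τ - r - 1) = t + τ by omega] at h3
    rw [show t + r + 1 + (τ - r - 2) = t + τ - 1 by omega] at h4
    exact hs (h3.trans h4.symm)
  have h2 : ∀ r < τ, σ (t + r) = σ t := by
    intro r
    induction r with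
    | zero => simp
    | succ k ih =>
      intro hk
      rw [← add_assoc, h1 k hk, ih (by omega)]
  refine ⟨fun h => hs ?_, h2⟩
  rw [← h, ← h2 (τ - 1) (by omega)]
  congr 1
  omega

theorem eucl_cont {n : ℕ} : Continuous (euclNorm (n := n)) := by
  unfold euclNorm
  fun_prop

theorem norm_le_eucl {n : ℕ} (x : Fin n → ℝ) : ‖x‖ ≤ euclNorm x := by
  refine (pi_norm_le_iff_of_nonneg (Real.sqrt_nonneg _)).2 fun i => ?_
  refine Real.le_sqrt_of_sq_le ?_
  rw [Real.norm_eq_abs, sq_abs]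
  exact Finset.single_le_sum (f := fun i => x i ^ 2) (fun i _ => sq_nonneg _) (Finset.mem_univ i)

/-- Theorem 1: MLF conditions imply global asymptotic stability with dwell-time `τ`. -/
theorem stmt0 {n m N : ℕ} (A : Fin N → Matrix (Fin n) (Fin n) ℝ)
    (B : Fin N → Matrix (Fin n) (Fin m) ℝ) (K : Fin N → Matrix (Fin m) (Fin n) ℝ)
    (τ : ℕ) (hτ : 1 ≤ τ)
    (P : Fin N → Matrix (Fin n) (Fin n) ℝ) (hP : ∀ i, (P i).PosDef)
    (h1 : ∀ x : Fin n → ℝ, x ≠ 0 → ∀ i : Fin N,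
      Fmode A B K i x ⬝ᵥ (P i).mulVec (Fmode A B K i x) - x ⬝ᵥ (P i).mulVec x < 0)
    (h2 : ∀ x : Fin n → ℝ, x ≠ 0 → ∀ i j : Fin N, i ≠ j →
      (Fmode A B K i)^[τ] x ⬝ᵥ (P j).mulVec ((Fmode A B K i)^[τ] x)
        < x ⬝ᵥ (P i).mulVec x) :
    (∀ ε > (0 : ℝ), ∃ δ > (0 : ℝ), ∀ σ : ℕ → Fin N, DTAdmissible τ σ →
      ∀ x : ℕ → Fin n → ℝ, Traj (Fmode A B K) σ x → euclNorm (x 0) ≤ δ →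
        ∀ t, euclNorm (x t) ≤ ε) ∧
    (∀ σ : ℕ → Fin N, DTAdmissible τ σ → ∀ x : ℕ → Fin n → ℝ,
      Traj (Fmode A B K) σ x → Tendsto x atTop (nhds 0)) := by
  have hc := Fmode_cont A B K
  have hz := Fmode_zero A B K
  have hzi : ∀ i, (Fmode A B K i)^[τ] 0 = 0 := fun i => Function.iterate_fixed (hz i) τ
  have h1' : ∀ i x, Fmode A B K i x ⬝ᵥ (P i).mulVec (Fmode A B K i x)
      ≤ x ⬝ᵥ (P i).mulVec x := by
    intro i x
    by_cases hx : x = 0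
    · simp [hx, hz]
    · linarith [h1 x hx i]
  have h2' : ∀ i j, i ≠ j → ∀ x, (Fmode A B K i)^[τ] x ⬝ᵥ (P j).mulVec ((Fmode A B K i)^[τ] x)
      ≤ x ⬝ᵥ (P i).mulVec x := by
    intro i j hij x
    by_cases hx : x = 0
    · simp [hx, hzi]
    · exact (h2 x hx i j hij).le
  have hbound : ∀ σ : ℕ → Fin N, DTAdmissible τ σ → ∀ x : ℕ → Fin n → ℝ,
      Traj (Fmode A B K) σ x → ∀ t, x t ⬝ᵥ (P (σ t)).mulVec (x t)
        ≤ x 0 ⬝ᵥ (P (σ 0)).mulVec (x 0) := by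
    intro σ hσ x hx
    refine seq_bound (fun t => x t ⬝ᵥ (P (σ t)).mulVec (x t)) τ hτ ?_ ?_
    · intro t
      induction t with
      | zero => simp
      | succ k ih =>
        intro hk
        refine le_trans ?_ (ih (by omega))
        rw [hσ.1 (k + 1) hk, ← hσ.1 k (by omega), hx k]
        exact h1' _ _
    · intro t
      rcases step_cases τ hτ σ hσ t with h | ⟨h, h'⟩
      · left
        have e := hx (t + τ - 1)
        rw [show t + τ - 1 + 1 = t + τ by omega] at e
        rw [h, e]
        exact h1' _ _
      · right
        rw [traj_const _ σ x hx t τ h']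
        exact h2' _ _ h _
  obtain ⟨a, ha, hlow⟩ := exists_common
    (fun (i : Fin N) a => ∀ x : Fin n → ℝ, a * ‖x‖ ^ 2 ≤ x ⬝ᵥ (P i).mulVec x)
    (fun i η η' hle h x => le_trans (by gcongr) (h x)) (fun i => quad_lower (P i) (hP i))
  refine ⟨?_, ?_⟩
  · intro ε hε
    obtain ⟨r, hr, hre⟩ := Metric.continuousAt_iff.1
      ((eucl_cont (n := n)).continuousAt (x := 0)) ε hε
    have h0 : euclNorm (0 : Fin n → ℝ) = 0 := by simp [euclNorm]
    obtain ⟨δ, hδ, hd⟩ := exists_common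
      (fun (i : Fin N) δ => ∀ x : Fin n → ℝ, ‖x‖ ≤ δ → x ⬝ᵥ (P i).mulVec x < a * r ^ 2)
      (fun i η η' hle h x hx => h x (hx.trans hle)) (by
        intro i
        obtain ⟨d, hd, h⟩ := Metric.continuousAt_iff.1
          ((quad_cont (P i)).continuousAt (x := 0)) (a * r ^ 2) (by positivity)
        refine ⟨d / 2, by positivity, fun x hx => ?_⟩
        have := h (x := x) (by rw [dist_zero_right]; linarith)
        simp only [mulVec_zero, dotProduct_zero, dist_zero_right] at this
        exact (le_abs_self _).trans_lt this)
    refine ⟨δ, hδ, fun σ hσ x hx hx0 t => ?_⟩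
    have e1 := hbound σ hσ x hx t
    have e2 := hd (σ 0) (x 0) ((norm_le_eucl _).trans hx0)
    have e3 := hlow (σ t) (x t)
    have e4 : ‖x t‖ ^ 2 < r ^ 2 := lt_of_mul_lt_mul_left (by linarith) ha.le
    have e5 : ‖x t‖ < r := lt_of_pow_lt_pow_left₀ 2 hr.le e4
    have := hre (x := x t) (by rwa [dist_zero_right])
    rw [h0, dist_zero_right] at this
    exact (le_abs_self _).trans this.le
  · intro σ hσ x hx
    have hb := hbound σ hσ x hx
    set C := x 0 ⬝ᵥ (P (σ 0)).mulVec (x 0) with hC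
    rw [Metric.tendsto_atTop]
    intro ε hε
    have hcpos : 0 < a * (ε / 2) ^ 2 := by positivity
    set c := a * (ε / 2) ^ 2 with hcdef
    obtain ⟨η₁, hη₁, H1⟩ := exists_common
      (fun (i : Fin N) η => ∀ y : Fin n → ℝ, y ⬝ᵥ (P i).mulVec y ≤ C →
        Fmode A B K i y ⬝ᵥ (P i).mulVec (Fmode A B K i y) ≤ c ∨
        Fmode A B K i y ⬝ᵥ (P i).mulVec (Fmode A B K i y) ≤ y ⬝ᵥ (P i).mulVec y - η)
      (fun i η η' hle h y hy => (h y hy).imp_right (fun h => by linarith))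
      (fun i => annulus (P i) (P i) (hP i) _ (hc i) (hz i)
        (fun x hx => by linarith [h1 x hx i]) c C hcpos)
    obtain ⟨η₂, hη₂, H2⟩ := exists_common
      (fun (q : {q : Fin N × Fin N // q.1 ≠ q.2}) η => ∀ y : Fin n → ℝ,
        y ⬝ᵥ (P q.1.1).mulVec y ≤ C →
        (Fmode A B K q.1.1)^[τ] y ⬝ᵥ (P q.1.2).mulVec ((Fmode A B K q.1.1)^[τ] y) ≤ c ∨
        (Fmode A B K q.1.1)^[τ] y ⬝ᵥ (P q.1.2).mulVec ((Fmode A B K q.1.1)^[τ] y)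
          ≤ y ⬝ᵥ (P q.1.1).mulVec y - η)
      (fun i η η' hle h y hy => (h y hy).imp_right (fun h => by linarith))
      (fun q => annulus (P q.1.1) (P q.1.2) (hP _) _ ((hc _).iterate τ) (hzi _)
        (fun x hx => h2 x hx _ _ q.2) c C hcpos)
    obtain ⟨T, hT⟩ := seq_conv (fun t => x t ⬝ᵥ (P (σ t)).mulVec (x t)) τ hτ c C
      (min η₁ η₂) (lt_min hη₁ hη₂) hb (by
        intro t
        rcases step_cases τ hτ σ hσ t with h | ⟨h, h'⟩
        · have e := hx (t + τ - 1)
          rw [show t + τ - 1 + 1 = t + τ by omega] at e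
          rw [h, e]
          rcases H1 _ _ (hb (t + τ - 1)) with h | h
          · exact Or.inl h
          · exact Or.inr (Or.inl (by linarith [min_le_left η₁ η₂]))
        · rw [traj_const _ σ x hx t τ h']
          rcases H2 ⟨(σ t, σ (t + τ)), h⟩ _ (hb t) with h | h
          · exact Or.inl h
          · exact Or.inr (Or.inr (h.trans (by linarith [min_le_right η₁ η₂]))))
    refine ⟨T, fun t ht => ?_⟩
    have e1 := hT t ht
    have e3 := hlow (σ t) (x t)
    have e4 : ‖x t‖ ^ 2 ≤ (ε / 2) ^ 2 := le_of_mul_le_mul_left (by linarith) ha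
    have e5 : ‖x t‖ ≤ ε / 2 := le_of_sq_le_sq e4 (by positivity)
    rw [dist_zero_right]
    linarith
end

section
/- For every u ∈ ℝ^m and every v ∈ ℝ^m with |v_j| ≤ 1 for all j = 1,…,m, the vector sat(u) lies in the convex hull of the finite set { D_{S^c} u + D_S v : S ⊆ {1,…,m} }. -/
open Matrix

/-- `D_S`: diagonal matrix with `1` on the diagonal entries indexed by `S`, `0` elsewhere. -/
def Dmat {m : ℕ} (S : Finset (Fin m)) : Matrix (Fin m) (Fin m) ℝ :=
  Matrix.diagonal fun j => if j ∈ S then 1 else 0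

/-- Lemma 2: `sat(u)` lies in the convex hull of `{D_{Sᶜ} u + D_S v : S ⊆ {1,…,m}}`
whenever `|v_j| ≤ 1` for all `j`. -/
theorem stmt2 {m : ℕ} (u v : Fin m → ℝ) (hv : ∀ j, |v j| ≤ 1) :
    satur u ∈ convexHull ℝ
      {w : Fin m → ℝ | ∃ S : Finset (Fin m),
        w = (Dmat Sᶜ).mulVec u + (Dmat S).mulVec v} := by
  classical
  have key : satur u ∈ convexHull ℝ (Set.univ.pi fun j => ({u j, v j} : Set ℝ)) := by
    apply mem_convexHull_pi
    intro j _
    rw [convexHull_pair, segment_eq_uIcc, Set.mem_uIcc]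
    have h := abs_le.mp (hv j)
    unfold satur
    rcases lt_trichotomy (u j) 0 with h0 | h0 | h0
    · rw [Real.sign_of_neg h0, abs_of_neg h0]
      rcases min_cases 1 (-(u j)) with ⟨h1, h2⟩ | ⟨h1, h2⟩ <;> rw [h1]
      · left; constructor <;> linarith
      · rcases le_total (u j) (v j) with h3 | h3
        · left; constructor <;> linarith
        · right; constructor <;> linarith
    · rw [h0]
      simpa using le_total 0 (v j)
    · rw [Real.sign_of_pos h0, abs_of_pos h0]
      rcases min_cases 1 (u j) with ⟨h1, h2⟩ | ⟨h1, h2⟩ <;> rw [h1]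
      · right; constructor <;> linarith
      · rcases le_total (u j) (v j) with h3 | h3
        · left; constructor <;> linarith
        · right; constructor <;> linarith
  refine convexHull_mono ?_ key
  intro w hw
  refine ⟨Finset.univ.filter fun j => w j ≠ u j, ?_⟩
  funext j
  have hj := hw j (Set.mem_univ j)
  simp only [Set.mem_insert_iff, Set.mem_singleton_iff] at hj
  simp only [Dmat, Pi.add_apply, Matrix.mulVec_diagonal, Finset.mem_compl, Finset.mem_filter,
    Finset.mem_univ, true_and]
  by_cases h : w j = u j
  · simp [h]
  · have h2 := hj.resolve_left h
    simp only [ne_eq, h, not_false_eq_true, not_true_eq_false, if_true, if_false]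
    rw [h2]; ring
end

section
/- Let H ∈ ℝ^{m×n}. For every x ∈ ℝ^n with ‖Hx‖_∞ ≤ 1 and every mode i, the successor state F_i(x) = A_i x + B_i sat(K_i x) lies in the convex hull of the finite set { E_{i,H}(x,S) : S ⊆ {1,…,m} }. -/
open Matrix

/-- `E_{i,H}(x,S) = (A + ∑_{j∈Sᶜ} B^{•j} K^{j•}) x + (∑_{j∈S} B^{•j} H^{j•}) x`. -/
noncomputable def Emap {n m : ℕ} (A : Matrix (Fin n) (Fin n) ℝ)
    (B : Matrix (Fin n) (Fin m) ℝ) (K H : Matrix (Fin m) (Fin n) ℝ)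
    (x : Fin n → ℝ) (S : Finset (Fin m)) : Fin n → ℝ :=
  (A + ∑ j ∈ Sᶜ, vecMulVec (fun r => B r j) (K j)).mulVec x
    + (∑ j ∈ S, vecMulVec (fun r => B r j) (H j)).mulVec x

theorem satur_aux (k h : ℝ) (hh : |h| ≤ 1) :
    Real.sign k * min 1 |k| ∈ convexHull ℝ ({k, h} : Set ℝ) := by
  rw [convexHull_pair, segment_eq_uIcc, Set.mem_uIcc]
  obtain ⟨h1, h2⟩ := abs_le.1 hh
  rcases lt_trichotomy k 0 with hk | hk | hk
  · rw [Real.sign_of_neg hk, abs_of_neg hk]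
    rcases le_total 1 (-k) with h3 | h3
    · rw [min_eq_left h3]; left; constructor <;> linarith
    · rw [min_eq_right h3]
      rcases le_total k h with h4 | h4
      · left; constructor <;> linarith
      · right; constructor <;> linarith
  · subst hk
    simp only [Real.sign_zero, zero_mul, le_refl, true_and, and_true]
    exact le_total 0 h
  · rw [Real.sign_of_pos hk, abs_of_pos hk]
    rcases le_total 1 k with h3 | h3
    · rw [min_eq_left h3]; right; constructor <;> linarith
    · rw [min_eq_right h3]
      rcases le_total k h with h4 | h4
      · left; constructor <;> linarith
      · right; constructor <;> linarith

theorem Emap_aux {n m : ℕ} (A : Matrix (Fin n) (Fin n) ℝ)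
    (B : Matrix (Fin n) (Fin m) ℝ) (K H : Matrix (Fin m) (Fin n) ℝ)
    (x : Fin n → ℝ) (S : Finset (Fin m)) (v : Fin m → ℝ)
    (h1 : ∀ j ∈ S, v j = H.mulVec x j) (h2 : ∀ j ∈ Sᶜ, v j = K.mulVec x j) :
    A.mulVec x + B.mulVec v = Emap A B K H x S := by
  have key : ∀ (T : Finset (Fin m)) (L : Matrix (Fin m) (Fin n) ℝ),
      (∀ j ∈ T, v j = L.mulVec x j) → ∀ r,
      (∑ j ∈ T, vecMulVec (fun r => B r j) (L j)).mulVec x r = ∑ j ∈ T, B r j * v j := by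
    intro T L hT r
    rw [Matrix.sum_mulVec, Finset.sum_apply]
    refine Finset.sum_congr rfl fun j hj => ?_
    rw [hT j hj]
    simp only [Matrix.mulVec, dotProduct, vecMulVec_apply, Finset.mul_sum, mul_assoc]
  ext r
  unfold Emap
  rw [Matrix.add_mulVec]
  simp only [Pi.add_apply]
  rw [key S H h1 r, key Sᶜ K h2 r, add_assoc, Finset.sum_compl_add_sum]
  rfl

/-- LDI representation of a single saturated step: for `‖Hx‖_∞ ≤ 1`,
`F_i(x) = A x + B sat(K x)` lies in the convex hull of the vertices `E_{i,H}(x,S)`. -/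
theorem stmt3 {n m : ℕ} (A : Matrix (Fin n) (Fin n) ℝ) (B : Matrix (Fin n) (Fin m) ℝ)
    (K H : Matrix (Fin m) (Fin n) ℝ) (x : Fin n → ℝ) (hx : ‖H.mulVec x‖ ≤ 1) :
    A.mulVec x + B.mulVec (satur (K.mulVec x)) ∈
      convexHull ℝ {y : Fin n → ℝ | ∃ S : Finset (Fin m), y = Emap A B K H x S} := by
  classical
  set g : (Fin m → ℝ) →ᵃ[ℝ] (Fin n → ℝ) :=
    (AffineMap.const ℝ (Fin m → ℝ) (A.mulVec x)) + (Matrix.mulVecLin B).toAffineMap with hg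
  have hgv : ∀ v, g v = A.mulVec x + B.mulVec v := fun v => rfl
  set C := convexHull ℝ {y : Fin n → ℝ | ∃ S : Finset (Fin m), y = Emap A B K H x S} with hC
  have hconv : Convex ℝ (g ⁻¹' C) := (convex_convexHull ℝ _).affine_preimage g
  have hsub : convexHull ℝ (Set.univ.pi fun j => ({K.mulVec x j, H.mulVec x j} : Set ℝ))
      ⊆ g ⁻¹' C := by
    refine convexHull_min (fun v hv => ?_) hconv
    refine subset_convexHull ℝ _ ⟨Finset.univ.filter fun j => v j = H.mulVec x j, ?_⟩
    rw [hgv]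
    refine Emap_aux A B K H x _ v (fun j hj => (Finset.mem_filter.1 hj).2) (fun j hj => ?_)
    rcases hv j (Set.mem_univ j) with h | h
    · exact h
    · exact absurd (Finset.mem_filter.2 ⟨Finset.mem_univ j, h⟩) (Finset.mem_compl.1 hj)
  refine hsub (a := satur (K.mulVec x)) ?_
  rw [convexHull_pi]
  intro j _
  exact satur_aux _ _ ((norm_le_pi_norm (H.mulVec x) j).trans hx)
end

section
/- Let t ≥ 1 and let H_{i,1},…,H_{i,t} ∈ ℝ^{m×n} be given. For every x ∈ ℝ^n satisfying ‖H_{i,k} x‖_∞ ≤ 1 for all k = 1,…,t, the t-step iterate F_i^t(x) lies in the convex hull of the finite set { E_i^t(x,S_1,…,S_t) : S_1,…,S_t ⊆ {1,…,m} }. -/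
open Matrix

/-- The closed-loop saturated map `F(x) = A x + B sat(K x)`. -/
noncomputable def Fmap {n m : ℕ} (A : Matrix (Fin n) (Fin n) ℝ)
    (B : Matrix (Fin n) (Fin m) ℝ) (K : Matrix (Fin m) (Fin n) ℝ)
    (x : Fin n → ℝ) : Fin n → ℝ :=
  A.mulVec x + B.mulVec (satur (K.mulVec x))

/-- Iterated vertex maps: `Eiter A B K H S x t` is `E_i^t(x, S_1, …, S_t)` where the
auxiliary matrix of the `k`-th nesting level is `H (k-1)` and `S_k = S (k-1)`. -/
noncomputable def Eiter {n m : ℕ} (A : Matrix (Fin n) (Fin n) ℝ)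
    (B : Matrix (Fin n) (Fin m) ℝ) (K : Matrix (Fin m) (Fin n) ℝ)
    (H : ℕ → Matrix (Fin m) (Fin n) ℝ) (S : ℕ → Finset (Fin m))
    (x : Fin n → ℝ) : ℕ → Fin n → ℝ
  | 0 => x
  | (k + 1) =>
      (A + ∑ j ∈ (S k)ᶜ, vecMulVec (fun r => B r j) (K j)).mulVec (Eiter A B K H S x k)
        + (∑ j ∈ S k, vecMulVec (fun r => B r j) (H k j)).mulVec x

theorem Eiter_congr_aux {n m : ℕ} (A : Matrix (Fin n) (Fin n) ℝ)
    (B : Matrix (Fin n) (Fin m) ℝ) (K : Matrix (Fin m) (Fin n) ℝ)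
    (H : ℕ → Matrix (Fin m) (Fin n) ℝ) (S T : ℕ → Finset (Fin m))
    (x : Fin n → ℝ) (t : ℕ) (h : ∀ k < t, S k = T k) :
    Eiter A B K H S x t = Eiter A B K H T x t := by
  induction t with
  | zero => rfl
  | succ t ih =>
    simp only [Eiter]
    rw [ih (fun k hk => h k (by omega)), h t (by omega)]

theorem convex_affine_aux {n k : ℕ} (M : Matrix (Fin n) (Fin k) ℝ) (c : Fin n → ℝ)
    {C : Set (Fin n → ℝ)} (hC : Convex ℝ C) :
    Convex ℝ {z : Fin k → ℝ | M.mulVec z + c ∈ C} := by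
  intro z hz w hw a b ha hb hab
  have := hC hz hw ha hb hab
  have e : M.mulVec (a • z + b • w) + c = a • (M.mulVec z + c) + b • (M.mulVec w + c) := by
    rw [Matrix.mulVec_add, Matrix.mulVec_smul, Matrix.mulVec_smul, smul_add, smul_add]
    have : c = a • c + b • c := by rw [← add_smul, hab, one_smul]
    nth_rewrite 1 [this]
    abel
  simpa only [Set.mem_ofPred_eq, e] using this

theorem vertex_aux {n m : ℕ} (A : Matrix (Fin n) (Fin n) ℝ)
    (B : Matrix (Fin n) (Fin m) ℝ) (K H : Matrix (Fin m) (Fin n) ℝ) (S : Finset (Fin m))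
    (z x : Fin n → ℝ) :
    (A + ∑ j ∈ Sᶜ, vecMulVec (fun r => B r j) (K j)).mulVec z
        + (∑ j ∈ S, vecMulVec (fun r => B r j) (H j)).mulVec x
      = B.mulVec (fun j => if j ∈ S then H.mulVec x j else K.mulVec z j) + A.mulVec z := by
  have e : B.mulVec (fun j => if j ∈ S then H.mulVec x j else K.mulVec z j)
      = (∑ j ∈ Sᶜ, vecMulVec (fun r => B r j) (K j)).mulVec z
        + (∑ j ∈ S, vecMulVec (fun r => B r j) (H j)).mulVec x := by
    rw [Matrix.sum_mulVec, Matrix.sum_mulVec]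
    ext r
    simp only [Pi.add_apply, Finset.sum_apply, Matrix.vecMulVec_mulVec]
    simp only [Matrix.mulVec, dotProduct]
    rw [← Finset.sum_compl_add_sum S]
    congr 1
    · refine Finset.sum_congr rfl fun j hj => ?_
      rw [if_neg (by simpa using hj)]
      simp [mul_comm]
    · refine Finset.sum_congr rfl fun j hj => ?_
      rw [if_pos hj]
      simp [mul_comm]
  rw [e, Matrix.add_mulVec]
  abel

theorem sat_aux (u h : ℝ) (hh : |h| ≤ 1) :
    Real.sign u * min 1 |u| ∈ convexHull ℝ ({h, u} : Set ℝ) := by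
  rw [convexHull_pair, segment_eq_uIcc, Set.mem_uIcc]
  obtain ⟨h1, h2⟩ := abs_le.mp hh
  rcases lt_trichotomy u 0 with hu | hu | hu
  · rw [Real.sign_of_neg hu, abs_of_neg hu]
    rcases le_total 1 (-u) with h3 | h3
    · rw [min_eq_left h3]; right; constructor <;> linarith
    · rw [min_eq_right h3]
      rcases le_total h u with h4 | h4
      · left; constructor <;> linarith
      · right; constructor <;> linarith
  · subst hu
    simp [le_total]
  · rw [Real.sign_of_pos hu, abs_of_pos hu]
    rcases le_total 1 u with h3 | h3
    · rw [min_eq_left h3]; left; constructor <;> linarith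
    · rw [min_eq_right h3]
      rcases le_total h u with h4 | h4
      · left; constructor <;> linarith
      · right; constructor <;> linarith

theorem stmt4_aux {n m : ℕ} (A : Matrix (Fin n) (Fin n) ℝ) (B : Matrix (Fin n) (Fin m) ℝ)
    (K : Matrix (Fin m) (Fin n) ℝ) (H : ℕ → Matrix (Fin m) (Fin n) ℝ)
    (t : ℕ) (x : Fin n → ℝ) (hx : ∀ k < t, ‖(H k).mulVec x‖ ≤ 1) :
    (Fmap A B K)^[t] x ∈
      convexHull ℝ {y : Fin n → ℝ | ∃ S : ℕ → Finset (Fin m), y = Eiter A B K H S x t} := by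
  classical
  induction t with
  | zero => exact subset_convexHull ℝ _ ⟨fun _ => ∅, rfl⟩
  | succ t ih =>
    have hz := ih (fun k hk => hx k (by omega))
    rw [Function.iterate_succ_apply']
    generalize (Fmap A B K)^[t] x = z at hz
    set C := convexHull ℝ {y : Fin n → ℝ | ∃ S : ℕ → Finset (Fin m),
      y = Eiter A B K H S x (t + 1)} with hCdef
    have hC : Convex ℝ C := convex_convexHull ℝ _
    have key : ∀ S : Finset (Fin m),
        B.mulVec (fun j => if j ∈ S then (H t).mulVec x j else K.mulVec z j)
          + A.mulVec z ∈ C := by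
      intro S
      rw [← vertex_aux]
      refine convexHull_min ?_ (convex_affine_aux _ _ hC) hz
      rintro _ ⟨T, rfl⟩
      refine subset_convexHull ℝ _ ⟨Function.update T t S, ?_⟩
      simp only [Eiter, Function.update_self]
      rw [Eiter_congr_aux A B K H (Function.update T t S) T x t
        (fun k hk => Function.update_of_ne (by omega) _ _)]
    have hs : satur (K.mulVec z) ∈ convexHull ℝ
        (Set.univ.pi fun j => ({(H t).mulVec x j, K.mulVec z j} : Set ℝ)) := by
      rw [convexHull_pi]
      intro j _
      exact sat_aux _ _ ((norm_le_pi_norm ((H t).mulVec x) j).trans (hx t (by omega)))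
    unfold Fmap
    rw [add_comm]
    refine convexHull_min ?_ (convex_affine_aux B (A.mulVec z) hC) hs
    intro p hp
    have := key (Finset.univ.filter fun j => p j = (H t).mulVec x j)
    change B.mulVec p + A.mulVec z ∈ C
    convert this using 3
    ext j
    have hj := hp j (Set.mem_univ j)
    simp only [Set.mem_insert_iff, Set.mem_singleton_iff] at hj
    simp only [Finset.mem_filter, Finset.mem_univ, true_and]
    split_ifs with h
    · exact h
    · exact hj.resolve_left h

/-- LDI representation of the `t`-step iterate: if `‖H_{i,k} x‖_∞ ≤ 1` for
`k = 1, …, t`, then `F_i^t(x)` lies in the convex hull of the vertices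
`E_i^t(x, S_1, …, S_t)` over all choices of subsets `S_1, …, S_t`. -/
theorem stmt4 {n m : ℕ} (A : Matrix (Fin n) (Fin n) ℝ) (B : Matrix (Fin n) (Fin m) ℝ)
    (K : Matrix (Fin m) (Fin n) ℝ) (H : ℕ → Matrix (Fin m) (Fin n) ℝ)
    (t : ℕ) (ht : 1 ≤ t) (x : Fin n → ℝ) (hx : ∀ k < t, ‖(H k).mulVec x‖ ≤ 1) :
    (Fmap A B K)^[t] x ∈
      convexHull ℝ {y : Fin n → ℝ | ∃ S : ℕ → Finset (Fin m), y = Eiter A B K H S x t} := by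
  exact stmt4_aux A B K H t x hx
end

section
/- Suppose for some integer τ ≥ 1 there exist symmetric positive definite matrices P_i and matrices H_{i,1},…,H_{i,τ} ∈ ℝ^{m×n} for each i ∈ {1,…,N} such that: (a) [E_i^1(x,S_1)]ᵀ P_i [E_i^1(x,S_1)] − xᵀ P_i x < 0 for all x ≠ 0, all i, and all S_1 ⊆ {1,…,m}; (b) [E_i^τ(x,S_1,…,S_τ)]ᵀ P_j [E_i^τ(x,S_1,…,S_τ)] − xᵀ P_i x < 0 for all x ≠ 0, all i ≠ j, and all S_1,…,S_τ ⊆ {1,…,m}; (c) E(P_i) ⊆ L(H_{i,k}) for all i and all k = 1,…,τ. Then the origin of the saturated switched system x(t+1) = F_{σ(t)}(x(t)) is locally asymptotically stable with dwell-time τ, and Ψ := ∩_{i=1}^N E(P_i) lies inside the domain of attraction: every trajectory under any DT-admissible switching signal with dwell-time τ starting from x(0) ∈ Ψ remains in ∪_{i=1}^N E(P_i) for all t and converges to 0 as t → ∞. -/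
open Matrix Filter

abbrev qf {n : ℕ} (P : Matrix (Fin n) (Fin n) ℝ) (x : Fin n → ℝ) : ℝ := x ⬝ᵥ P.mulVec x

lemma qf_cont {n : ℕ} (P : Matrix (Fin n) (Fin n) ℝ) : Continuous (qf P) := by
  unfold qf
  exact Continuous.dotProduct continuous_id (Continuous.matrix_mulVec continuous_const continuous_id)

lemma qf_smul {n : ℕ} (P : Matrix (Fin n) (Fin n) ℝ) (c : ℝ) (x : Fin n → ℝ) :
    qf P (c • x) = c ^ 2 * qf P x := by
  simp only [qf, mulVec_smul, smul_dotProduct, dotProduct_smul, smul_eq_mul]; ring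

lemma qf_pos {n : ℕ} {P : Matrix (Fin n) (Fin n) ℝ} (hP : P.PosDef) {x : Fin n → ℝ} (hx : x ≠ 0) :
    0 < qf P x := by
  have := hP.dotProduct_mulVec_pos hx
  simpa using this

lemma qf_nonneg {n : ℕ} {P : Matrix (Fin n) (Fin n) ℝ} (hP : P.PosDef) (x : Fin n → ℝ) :
    0 ≤ qf P x := by
  by_cases hx : x = 0
  · simp [hx, qf]
  · exact (qf_pos hP hx).le

lemma qf_convex {n : ℕ} {P : Matrix (Fin n) (Fin n) ℝ} (hP : P.PosDef) :
    ConvexOn ℝ Set.univ (qf P) := by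
  refine ⟨convex_univ, fun x _ y _ a b ha hb hab => ?_⟩
  have h := qf_nonneg hP (x - y)
  have e : a * qf P x + b * qf P y - qf P (a • x + b • y) = a * b * qf P (x - y) := by
    have hb' : b = 1 - a := by linarith
    subst hb'
    simp only [qf, mulVec_add, mulVec_sub, mulVec_smul, add_dotProduct, sub_dotProduct,
      dotProduct_add, dotProduct_sub, smul_dotProduct, dotProduct_smul, smul_eq_mul]
    ring
  have := mul_nonneg (mul_nonneg ha hb) h
  simp only [smul_eq_mul]
  linarith

lemma ratio {n : ℕ} (f g : (Fin n → ℝ) → ℝ) (hf : Continuous f) (hg : Continuous g)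
    (hf2 : ∀ c x, f (c • x) = c ^ 2 * f x) (hg2 : ∀ c x, g (c • x) = c ^ 2 * g x)
    (hpos : ∀ x, x ≠ 0 → 0 < g x) :
    ∃ C, (∀ x, f x ≤ C * g x) ∧ (C = 0 ∨ ∃ x, x ≠ 0 ∧ f x = C * g x) := by
  have f0 : f 0 = 0 := by have := hf2 0 0; simpa using this
  have g0 : g 0 = 0 := by have := hg2 0 0; simpa using this
  by_cases hne : (Metric.sphere (0 : Fin n → ℝ) 1).Nonempty
  · have hs : ∀ x ∈ Metric.sphere (0 : Fin n → ℝ) 1, x ≠ 0 := by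
      rintro x hx rfl; simp at hx
    obtain ⟨z, hz, hmax⟩ := (isCompact_sphere (0 : Fin n → ℝ) 1).exists_isMaxOn hne
      (f := fun x => f x / g x)
      (hf.continuousOn.div hg.continuousOn (fun x hx => (hpos x (hs x hx)).ne'))
    refine ⟨f z / g z, fun x => ?_, Or.inr ⟨z, hs z hz, ?_⟩⟩
    · by_cases hx : x = 0
      · simp [hx, f0, g0]
      · have hn : 0 < ‖x‖ := norm_pos_iff.mpr hx
        have hy : (‖x‖⁻¹ • x) ∈ Metric.sphere (0 : Fin n → ℝ) 1 := by
          simp [norm_smul, hn.ne']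
        have h := hmax hy
        simp only [Set.mem_ofPred_eq] at h
        rw [hf2, hg2, mul_div_mul_left _ _ (by positivity), div_le_iff₀ (hpos x hx)] at h
        exact h
    · have := (hpos z (hs z hz)).ne'
      field_simp
  · refine ⟨0, fun x => ?_, Or.inl rfl⟩
    by_cases hx : x = 0
    · simp [hx, f0]
    · exfalso; apply hne
      have hn : 0 < ‖x‖ := norm_pos_iff.mpr hx
      exact ⟨‖x‖⁻¹ • x, by simp [norm_smul, hn.ne']⟩

lemma sat_seg (u v : ℝ) (hv : |v| ≤ 1) :
    ∃ a b : ℝ, 0 ≤ a ∧ 0 ≤ b ∧ a + b = 1 ∧ a * u + b * v = Real.sign u * min 1 |u| := by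
  have key : Real.sign u * min 1 |u| ∈ segment ℝ u v := by
    rw [segment_eq_uIcc, Set.mem_uIcc]
    rw [abs_le] at hv
    rcases lt_trichotomy u 0 with h | h | h
    · rw [Real.sign_of_neg h, abs_of_neg h]
      rcases le_total 1 (-u) with h1 | h1
      · rw [min_eq_left h1]; left; constructor <;> linarith
      · rw [min_eq_right h1]
        rcases le_total u v with h2 | h2
        · left; constructor <;> linarith
        · right; constructor <;> linarith
    · subst h; simp [le_total]
    · rw [Real.sign_of_pos h, abs_of_pos h]
      rcases le_total 1 u with h1 | h1
      · rw [min_eq_left h1]; right; constructor <;> linarith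
      · rw [min_eq_right h1]
        rcases le_total u v with h2 | h2
        · left; constructor <;> linarith
        · right; constructor <;> linarith
  obtain ⟨a, b, h1, h2, h3, h4⟩ := key
  exact ⟨a, b, h1, h2, h3, by simpa using h4⟩

lemma sum_vmv {n m : ℕ} (B : Matrix (Fin n) (Fin m) ℝ) (K : Matrix (Fin m) (Fin n) ℝ)
    (S : Finset (Fin m)) (y : Fin n → ℝ) :
    (∑ j ∈ S, vecMulVec (fun r => B r j) (K j)).mulVec y
      = B.mulVec (fun j => if j ∈ S then K.mulVec y j else 0) := by
  rw [Matrix.sum_mulVec]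
  ext r
  simp only [Finset.sum_apply, vecMulVec_mulVec]
  simp [mulVec, dotProduct, Finset.sum_ite_mem, mul_comm]

lemma vertex_step {n m : ℕ} (A : Matrix (Fin n) (Fin n) ℝ)
    (B : Matrix (Fin n) (Fin m) ℝ) (K H : Matrix (Fin m) (Fin n) ℝ) (x y : Fin n → ℝ)
    (a b : Fin m → ℝ) (ha : ∀ j, 0 ≤ a j) (hb : ∀ j, 0 ≤ b j) (hab : ∀ j, a j + b j = 1) :
    A.mulVec y + B.mulVec (fun j => a j * K.mulVec y j + b j * H.mulVec x j) ∈
    convexHull ℝ (Set.range fun S : Finset (Fin m) =>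
      (A + ∑ j ∈ Sᶜ, vecMulVec (fun r => B r j) (K j)).mulVec y
        + (∑ j ∈ S, vecMulVec (fun r => B r j) (H j)).mulVec x) := by
  set C := convexHull ℝ (Set.range fun S : Finset (Fin m) =>
      (A + ∑ j ∈ Sᶜ, vecMulVec (fun r => B r j) (K j)).mulVec y
        + (∑ j ∈ S, vecMulVec (fun r => B r j) (H j)).mulVec x) with hC
  have hv : (fun j => a j * K.mulVec y j + b j * H.mulVec x j) ∈
      convexHull ℝ (Set.univ.pi fun j => ({K.mulVec y j, H.mulVec x j} : Set ℝ)) := by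
    rw [convexHull_pi]
    intro j _
    show _ ∈ convexHull ℝ _
    rw [convexHull_pair]
    exact ⟨a j, b j, ha j, hb j, hab j, by simp⟩
  have hconv : Convex ℝ (B.mulVecLin ⁻¹' ((fun z => A.mulVec y + z) ⁻¹' C)) :=
    ((convex_convexHull ℝ _).translate_preimage_right _).linear_preimage _
  refine convexHull_min ?_ hconv hv
  classical
  intro w hw
  refine subset_convexHull ℝ _ ⟨Finset.univ.filter (fun j => w j ≠ K.mulVec y j), ?_⟩
  simp only [add_mulVec, sum_vmv, add_assoc, mulVecLin_apply]
  rw [← mulVec_add]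
  congr 2
  ext j
  have := hw j trivial
  simp only [Set.mem_insert_iff, Set.mem_singleton_iff] at this
  by_cases h : w j = K.mulVec y j
  · simp [h]
  · have h2 := this.resolve_left h
    simp only [Pi.add_apply, Finset.mem_compl, Finset.mem_filter, Finset.mem_univ, true_and, h,
      not_false_iff, ne_eq, not_true, if_true, if_false, zero_add]
    exact h2.symm

lemma Eiter_congr {n m : ℕ} (A : Matrix (Fin n) (Fin n) ℝ)
    (B : Matrix (Fin n) (Fin m) ℝ) (K : Matrix (Fin m) (Fin n) ℝ)
    (H : ℕ → Matrix (Fin m) (Fin n) ℝ) (S S' : ℕ → Finset (Fin m)) (x : Fin n → ℝ) (k : ℕ)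
    (h : ∀ l < k, S l = S' l) : Eiter A B K H S x k = Eiter A B K H S' x k := by
  induction k with
  | zero => rfl
  | succ k ih =>
    simp only [Eiter]
    rw [ih (fun l hl => h l (by omega)), h k (by omega)]

lemma Eiter_lin {n m : ℕ} (A : Matrix (Fin n) (Fin n) ℝ)
    (B : Matrix (Fin n) (Fin m) ℝ) (K : Matrix (Fin m) (Fin n) ℝ)
    (H : ℕ → Matrix (Fin m) (Fin n) ℝ) (S : ℕ → Finset (Fin m)) (k : ℕ) :
    ∃ M : Matrix (Fin n) (Fin n) ℝ, ∀ x, Eiter A B K H S x k = M.mulVec x := by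
  induction k with
  | zero => exact ⟨1, fun x => by simp [Eiter]⟩
  | succ k ih =>
    obtain ⟨M, hM⟩ := ih
    refine ⟨(A + ∑ j ∈ (S k)ᶜ, vecMulVec (fun r => B r j) (K j)) * M +
      ∑ j ∈ S k, vecMulVec (fun r => B r j) (H k j), fun x => ?_⟩
    simp only [Eiter, hM]
    rw [mulVec_mulVec, ← add_mulVec]

lemma hull_step {n m : ℕ} (A : Matrix (Fin n) (Fin n) ℝ)
    (B : Matrix (Fin n) (Fin m) ℝ) (K : Matrix (Fin m) (Fin n) ℝ)
    (H : ℕ → Matrix (Fin m) (Fin n) ℝ) (x y : Fin n → ℝ) (k : ℕ)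
    (hH : ‖(H k).mulVec x‖ ≤ 1)
    (hy : y ∈ convexHull ℝ (Set.range fun S => Eiter A B K H S x k)) :
    A.mulVec y + B.mulVec (satur (K.mulVec y)) ∈
      convexHull ℝ (Set.range fun S => Eiter A B K H S x (k + 1)) := by
  have h1 : ∀ j, |(H k).mulVec x j| ≤ 1 := fun j => (norm_le_pi_norm _ j).trans hH
  choose a b ha hb hab hs using fun j => sat_seg (K.mulVec y j) ((H k).mulVec x j) (h1 j)
  have e : satur (K.mulVec y) = fun j => a j * K.mulVec y j + b j * (H k).mulVec x j := by
    ext j; rw [hs]; rfl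
  rw [e]
  set C := convexHull ℝ (Set.range fun S => Eiter A B K H S x (k + 1)) with hC
  let M : Matrix (Fin n) (Fin n) ℝ := A + B * (Matrix.diagonal a * K)
  let c : Fin n → ℝ := B.mulVec (fun j => b j * (H k).mulVec x j)
  have eM : ∀ z, A.mulVec z + B.mulVec (fun j => a j * K.mulVec z j + b j * (H k).mulVec x j)
      = c + M.mulVecLin z := by
    intro z
    simp only [M, c, mulVecLin_apply, add_mulVec, ← mulVec_mulVec]
    rw [add_left_comm, ← mulVec_add]
    congr 2
    ext j
    rw [Pi.add_apply, mulVec_diagonal, add_comm]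
  have hconv : Convex ℝ (M.mulVecLin ⁻¹' ((fun z => c + z) ⁻¹' C)) :=
    ((convex_convexHull ℝ _).translate_preimage_right _).linear_preimage _
  rw [eM]
  refine convexHull_min ?_ hconv hy
  rintro _ ⟨S, rfl⟩
  show c + M.mulVecLin _ ∈ C
  rw [← eM]
  refine convexHull_mono ?_ (vertex_step A B K (H k) x _ a b ha hb hab)
  rintro _ ⟨T, rfl⟩
  refine ⟨Function.update S k T, ?_⟩
  simp only [Eiter, Function.update_self]
  rw [Eiter_congr A B K H (Function.update S k T) S x k
    (fun l hl => Function.update_of_ne (by omega) _ _)]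

lemma traj_hull {n m N : ℕ} (A : Fin N → Matrix (Fin n) (Fin n) ℝ)
    (B : Fin N → Matrix (Fin n) (Fin m) ℝ) (K : Fin N → Matrix (Fin m) (Fin n) ℝ)
    (H : ℕ → Matrix (Fin m) (Fin n) ℝ) (σ : ℕ → Fin N) (x : ℕ → Fin n → ℝ)
    (hx : Traj (Fmode A B K) σ x) (i : Fin N) (s k : ℕ) (hσ : ∀ r < k, σ (s + r) = i)
    (hH : ∀ r < k, ‖(H r).mulVec (x s)‖ ≤ 1) :
    x (s + k) ∈ convexHull ℝ (Set.range fun S => Eiter (A i) (B i) (K i) H S (x s) k) := by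
  induction k with
  | zero => exact subset_convexHull ℝ _ ⟨fun _ => ∅, rfl⟩
  | succ k ih =>
    have := hull_step (A i) (B i) (K i) H (x s) _ k (hH k (by omega))
      (ih (fun r hr => hσ r (by omega)) (fun r hr => hH r (by omega)))
    rw [← add_assoc, hx (s + k), hσ k (by omega)]
    exact this

lemma dwell {N τ : ℕ} {σ : ℕ → Fin N} (h : DTAdmissible τ σ) (t : ℕ)
    (hs : σ (t + 1) ≠ σ t) : ∃ s, s + τ = t + 1 ∧ ∀ r < τ, σ (s + r) = σ t := by
  have h1 : τ ≤ t + 1 := by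
    by_contra hc
    exact hs ((h.1 _ (by omega)).trans (h.1 _ (by omega)).symm)
  refine ⟨t + 1 - τ, by omega, ?_⟩
  have h2 : ∀ u, t + 1 - τ ≤ u → u < t → σ (u + 1) = σ u := by
    intro u hu hut
    by_contra hc
    have a1 := h.2 u hc (t - u) (by omega)
    have a2 := h.2 u hc (t - u - 1) (by omega)
    rw [show u + 1 + (t - u) = t + 1 by omega] at a1
    rw [show u + 1 + (t - u - 1) = t by omega] at a2
    exact hs (a1.trans a2.symm)
  have h3 : ∀ d, d ≤ t → t + 1 - τ ≤ t - d → σ (t - d) = σ t := by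
    intro d
    induction d with
    | zero => intros; rfl
    | succ d ih =>
      intro hd hd2
      rw [← ih (by omega) (by omega), ← h2 (t - (d + 1)) hd2 (by omega)]
      congr 1; omega
  intro r hr
  have := h3 (τ - 1 - r) (by omega) (by omega)
  rw [← this]; congr 1; omega

lemma contr1 {n : ℕ} (P Q M : Matrix (Fin n) (Fin n) ℝ) (hP : P.PosDef)
    (h : ∀ x, x ≠ 0 → qf Q (M.mulVec x) < qf P x) :
    ∀ᶠ l in nhdsWithin (1 : ℝ) (Set.Iio 1), ∀ x, qf Q (M.mulVec x) ≤ l * qf P x := by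
  obtain ⟨C, hC, hC2⟩ := ratio (fun x => qf Q (M.mulVec x)) (qf P)
    ((qf_cont Q).comp (Continuous.matrix_mulVec continuous_const continuous_id)) (qf_cont P)
    (fun c x => by simp only [mulVec_smul, qf_smul]) (qf_smul P) (fun x hx => qf_pos hP hx)
  have hlt : C < 1 := by
    rcases hC2 with rfl | ⟨x, hx, e⟩
    · norm_num
    · have h1 := h x hx
      have h2 := qf_pos hP hx
      rw [e] at h1
      by_contra hc
      nlinarith
  filter_upwards [mem_nhdsWithin_of_mem_nhds (Ioi_mem_nhds hlt)] with l hl x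
  exact (hC x).trans (mul_le_mul_of_nonneg_right (le_of_lt hl) (qf_nonneg hP x))

lemma contr {n m N : ℕ} (A : Fin N → Matrix (Fin n) (Fin n) ℝ)
    (B : Fin N → Matrix (Fin n) (Fin m) ℝ) (K : Fin N → Matrix (Fin m) (Fin n) ℝ)
    (P : Fin N → Matrix (Fin n) (Fin n) ℝ) (hP : ∀ i, (P i).PosDef)
    (H : Fin N → ℕ → Matrix (Fin m) (Fin n) ℝ) (k : ℕ) (i j : Fin N)
    (h : ∀ x : Fin n → ℝ, x ≠ 0 → ∀ S : ℕ → Finset (Fin m),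
      qf (P j) (Eiter (A i) (B i) (K i) (H i) S x k) < qf (P i) x) :
    ∀ᶠ l in nhdsWithin (1 : ℝ) (Set.Iio 1), ∀ x, ∀ S : ℕ → Finset (Fin m),
      qf (P j) (Eiter (A i) (B i) (K i) (H i) S x k) ≤ l * qf (P i) x := by
  classical
  let ex : (Fin k → Finset (Fin m)) → ℕ → Finset (Fin m) :=
    fun T l => if h : l < k then T ⟨l, h⟩ else ∅
  have h1 : ∀ T : Fin k → Finset (Fin m), ∀ᶠ l in nhdsWithin (1 : ℝ) (Set.Iio 1), ∀ x,
      qf (P j) (Eiter (A i) (B i) (K i) (H i) (ex T) x k) ≤ l * qf (P i) x := by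
    intro T
    obtain ⟨M, hM⟩ := Eiter_lin (A i) (B i) (K i) (H i) (ex T) k
    simp only [hM]
    apply contr1 _ _ _ (hP i)
    intro x hx
    rw [← hM]
    exact h x hx _
  filter_upwards [eventually_all.2 h1] with l hl x S
  have := hl (fun q => S q) x
  rwa [Eiter_congr _ _ _ _ _ S x k (fun q hq => by simp [ex, hq])] at this

lemma decay {n m N : ℕ} (A : Fin N → Matrix (Fin n) (Fin n) ℝ)
    (B : Fin N → Matrix (Fin n) (Fin m) ℝ) (K : Fin N → Matrix (Fin m) (Fin n) ℝ)
    (τ : ℕ) (hτ : 1 ≤ τ)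
    (P : Fin N → Matrix (Fin n) (Fin n) ℝ) (hP : ∀ i, (P i).PosDef)
    (H : Fin N → ℕ → Matrix (Fin m) (Fin n) ℝ)
    (ha : ∀ x : Fin n → ℝ, x ≠ 0 → ∀ i : Fin N, ∀ S : ℕ → Finset (Fin m),
      qf (P i) (Eiter (A i) (B i) (K i) (H i) S x 1) < qf (P i) x)
    (hb : ∀ x : Fin n → ℝ, x ≠ 0 → ∀ i j : Fin N, i ≠ j → ∀ S : ℕ → Finset (Fin m),
      qf (P j) (Eiter (A i) (B i) (K i) (H i) S x τ) < qf (P i) x)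
    (hc : ∀ i : Fin N, ∀ k < τ, ∀ x, qf (P i) x ≤ 1 → ‖(H i k).mulVec x‖ ≤ 1) :
    ∃ l : ℝ, 0 ≤ l ∧ l < 1 ∧ ∀ σ : ℕ → Fin N, DTAdmissible τ σ → ∀ x : ℕ → Fin n → ℝ,
      Traj (Fmode A B K) σ x → qf (P (σ 0)) (x 0) ≤ 1 →
      ∀ t, qf (P (σ t)) (x t) ≤ l ^ (t / τ) * qf (P (σ 0)) (x 0) := by
  have e1 := eventually_all.2 fun i => contr A B K P hP H 1 i i (fun x hx S => ha x hx i S)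
  have e2 : ∀ᶠ l in nhdsWithin (1 : ℝ) (Set.Iio 1), ∀ i j, i ≠ j → ∀ x, ∀ S : ℕ → Finset (Fin m),
      qf (P j) (Eiter (A i) (B i) (K i) (H i) S x τ) ≤ l * qf (P i) x := by
    refine eventually_all.2 fun i => eventually_all.2 fun j => ?_
    by_cases hij : i = j
    · exact Eventually.of_forall fun l h => absurd hij h
    · filter_upwards [contr A B K P hP H τ i j (fun x hx S => hb x hx i j hij S)] with l hl _
      exact hl
  have e3 : ∀ᶠ l in nhdsWithin (1 : ℝ) (Set.Iio 1), l < 1 := self_mem_nhdsWithin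
  have e4 : ∀ᶠ l in nhdsWithin (1 : ℝ) (Set.Iio 1), (0 : ℝ) < l :=
    mem_nhdsWithin_of_mem_nhds (Ioi_mem_nhds one_pos)
  obtain ⟨l, ⟨⟨h1, h2⟩, h3⟩, h4⟩ := (((e1.and e2).and e3).and e4).exists
  refine ⟨l, h4.le, h3, fun σ hσ x hx hx0 t => ?_⟩
  have w0 := qf_nonneg (hP (σ 0)) (x 0)
  induction t using Nat.strong_induction_on with
  | _ t ih =>
  have hle : ∀ s < t, qf (P (σ s)) (x s) ≤ 1 := fun s hs =>
    (ih s hs).trans (mul_le_one₀ (pow_le_one₀ h4.le h3.le) w0 hx0)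
  cases t with
  | zero => simp
  | succ t =>
    by_cases hs : σ (t + 1) = σ t
    · have hm := traj_hull A B K (H (σ t)) σ x hx (σ t) t 1
        (fun r hr => by rw [show r = 0 by omega]; rfl)
        (fun r hr => hc _ _ (by omega) _ (hle t (by omega)))
      obtain ⟨_, ⟨S, rfl⟩, hS⟩ :=
        ((qf_convex (hP (σ t))).subset (Set.subset_univ _) (convex_convexHull ℝ _)).exists_ge_of_mem_convexHull
          (subset_convexHull ℝ _) hm
      rw [hs]
      calc _ ≤ l * qf (P (σ t)) (x t) := hS.trans (h1 _ _ _)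
        _ ≤ l * (l ^ (t / τ) * qf (P (σ 0)) (x 0)) :=
          mul_le_mul_of_nonneg_left (ih t (by omega)) h4.le
        _ = l ^ (t / τ + 1) * qf (P (σ 0)) (x 0) := by ring
        _ ≤ _ := by
          refine mul_le_mul_of_nonneg_right (pow_le_pow_of_le_one h4.le h3.le ?_) w0
          rw [← Nat.add_div_right _ (by omega : 0 < τ)]
          exact Nat.div_le_div_right (by omega)
    · obtain ⟨s, hst, hr⟩ := dwell hσ t hs
      have hs0 : σ s = σ t := hr 0 (by omega)
      have hm := traj_hull A B K (H (σ t)) σ x hx (σ t) s τ hr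
        (fun r hr => hc _ _ (by omega) _ (hs0 ▸ hle s (by omega)))
      obtain ⟨_, ⟨S, rfl⟩, hS⟩ :=
        ((qf_convex (hP (σ (t + 1)))).subset (Set.subset_univ _) (convex_convexHull ℝ _)).exists_ge_of_mem_convexHull
          (subset_convexHull ℝ _) hm
      rw [hst] at hS
      calc _ ≤ l * qf (P (σ t)) (x s) := hS.trans (h2 _ _ (Ne.symm hs) _ _)
        _ = l * qf (P (σ s)) (x s) := by rw [hs0]
        _ ≤ l * (l ^ (s / τ) * qf (P (σ 0)) (x 0)) :=
          mul_le_mul_of_nonneg_left (ih s (by omega)) h4.le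
        _ = l ^ (s / τ + 1) * qf (P (σ 0)) (x 0) := by ring
        _ = _ := by rw [← Nat.add_div_right _ (by omega : 0 < τ), hst]

lemma equivb {n N : ℕ} (P : Fin N → Matrix (Fin n) (Fin n) ℝ) (hP : ∀ i, (P i).PosDef) :
    ∃ C : ℝ, 1 ≤ C ∧ ∀ i x, (∑ q, x q ^ 2) ≤ C * qf (P i) x ∧ qf (P i) x ≤ C * ∑ q, x q ^ 2 := by
  have c : Continuous fun x : Fin n → ℝ => ∑ q, x q ^ 2 := by fun_prop
  have hs : ∀ (a : ℝ) (x : Fin n → ℝ), ∑ q, (a • x) q ^ 2 = a ^ 2 * ∑ q, x q ^ 2 := by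
    intro a x; simp [mul_pow, Finset.mul_sum]
  have hn : ∀ x : Fin n → ℝ, 0 ≤ ∑ q, x q ^ 2 := fun x => Finset.sum_nonneg fun q _ => sq_nonneg _
  have hp : ∀ x : Fin n → ℝ, x ≠ 0 → 0 < ∑ q, x q ^ 2 := by
    intro x hx
    obtain ⟨q, hq⟩ := Function.ne_iff.1 hx
    exact Finset.sum_pos' (fun q _ => sq_nonneg _) ⟨q, Finset.mem_univ _, by
      have : x q ≠ 0 := hq
      positivity⟩
  have : ∀ᶠ C : ℝ in atTop, ∀ i x, (∑ q, x q ^ 2) ≤ C * qf (P i) x ∧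
      qf (P i) x ≤ C * ∑ q, x q ^ 2 := by
    refine eventually_all.2 fun i => ?_
    obtain ⟨C1, h1, -⟩ := ratio _ (qf (P i)) c (qf_cont _) hs (qf_smul _) (fun x => qf_pos (hP i))
    obtain ⟨C2, h2, -⟩ := ratio (qf (P i)) _ (qf_cont _) c (qf_smul _) hs hp
    filter_upwards [eventually_ge_atTop C1, eventually_ge_atTop C2] with C a1 a2 x
    exact ⟨(h1 x).trans (mul_le_mul_of_nonneg_right a1 (qf_nonneg (hP i) x)),
      (h2 x).trans (mul_le_mul_of_nonneg_right a2 (hn x))⟩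
  obtain ⟨C, h1, h2⟩ := ((eventually_ge_atTop (1:ℝ)).and this).exists
  exact ⟨C, h1, h2⟩

/-- Theorem 2: LDI-based MLF conditions give local asymptotic stability with dwell-time
`τ`, and `Ψ = ∩ᵢ E(Pᵢ)` lies inside the domain of attraction: trajectories starting in
`Ψ` remain in `∪ᵢ E(Pᵢ)` and converge to the origin.  The auxiliary matrix `H i (k-1)`
plays the role of `H_{i,k}` for `k = 1, …, τ`. -/
theorem stmt6 {n m N : ℕ} (A : Fin N → Matrix (Fin n) (Fin n) ℝ)
    (B : Fin N → Matrix (Fin n) (Fin m) ℝ) (K : Fin N → Matrix (Fin m) (Fin n) ℝ)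
    (τ : ℕ) (hτ : 1 ≤ τ)
    (P : Fin N → Matrix (Fin n) (Fin n) ℝ) (hP : ∀ i, (P i).PosDef)
    (H : Fin N → ℕ → Matrix (Fin m) (Fin n) ℝ)
    (ha : ∀ x : Fin n → ℝ, x ≠ 0 → ∀ i : Fin N, ∀ S : ℕ → Finset (Fin m),
      Eiter (A i) (B i) (K i) (H i) S x 1 ⬝ᵥ
          (P i).mulVec (Eiter (A i) (B i) (K i) (H i) S x 1)
        - x ⬝ᵥ (P i).mulVec x < 0)
    (hb : ∀ x : Fin n → ℝ, x ≠ 0 → ∀ i j : Fin N, i ≠ j → ∀ S : ℕ → Finset (Fin m),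
      Eiter (A i) (B i) (K i) (H i) S x τ ⬝ᵥ
          (P j).mulVec (Eiter (A i) (B i) (K i) (H i) S x τ)
        - x ⬝ᵥ (P i).mulVec x < 0)
    (hc : ∀ i : Fin N, ∀ k < τ,
      {x : Fin n → ℝ | x ⬝ᵥ (P i).mulVec x ≤ 1} ⊆
        {x : Fin n → ℝ | ‖(H i k).mulVec x‖ ≤ 1}) :
    (∀ ε > (0 : ℝ), ∃ δ > (0 : ℝ), ∀ σ : ℕ → Fin N, DTAdmissible τ σ →
      ∀ x : ℕ → Fin n → ℝ, Traj (Fmode A B K) σ x → euclNorm (x 0) ≤ δ →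
        ∀ t, euclNorm (x t) ≤ ε) ∧
    (∀ σ : ℕ → Fin N, DTAdmissible τ σ → ∀ x : ℕ → Fin n → ℝ,
      Traj (Fmode A B K) σ x → (∀ i, x 0 ⬝ᵥ (P i).mulVec (x 0) ≤ 1) →
        (∀ t, ∃ i, x t ⬝ᵥ (P i).mulVec (x t) ≤ 1) ∧ Tendsto x atTop (nhds 0)) := by
  obtain ⟨l, l0, l1, hd⟩ := decay A B K τ hτ P hP H (fun x hx i S => sub_neg.1 (ha x hx i S))
    (fun x hx i j hij S => sub_neg.1 (hb x hx i j hij S)) (fun i k hk x hx => hc i k hk hx)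
  obtain ⟨C, hC1, hC⟩ := equivb P hP
  have C0 : 0 < C := by linarith
  have hW : ∀ σ : ℕ → Fin N, DTAdmissible τ σ → ∀ x : ℕ → Fin n → ℝ,
      Traj (Fmode A B K) σ x → qf (P (σ 0)) (x 0) ≤ 1 →
      ∀ t, qf (P (σ t)) (x t) ≤ qf (P (σ 0)) (x 0) := by
    intro σ hσ x hx h0 t
    exact (hd σ hσ x hx h0 t).trans
      (mul_le_of_le_one_left (qf_nonneg (hP _) _) (pow_le_one₀ l0 l1.le))
  constructor
  · intro ε hε
    refine ⟨min ε 1 / C, by positivity, fun σ hσ x hx h0 t => ?_⟩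
    have hm : 0 < min ε 1 := by positivity
    have h1 : ∑ q, x 0 q ^ 2 ≤ (min ε 1 / C) ^ 2 := Real.sqrt_le_iff.1 h0 |>.2
    have h2 : qf (P (σ 0)) (x 0) ≤ C * (min ε 1 / C) ^ 2 :=
      (hC _ _).2.trans (mul_le_mul_of_nonneg_left h1 C0.le)
    have e1 : C * (min ε 1 / C) ^ 2 = (min ε 1) ^ 2 / C := by field_simp
    have h3 : qf (P (σ 0)) (x 0) ≤ 1 := by
      refine h2.trans ?_
      rw [e1, div_le_one C0]
      exact (pow_le_one₀ hm.le (min_le_right _ _)).trans hC1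
    have h4 := hW σ hσ x hx h3 t
    refine Real.sqrt_le_iff.2 ⟨hε.le, ?_⟩
    calc _ ≤ C * qf (P (σ t)) (x t) := (hC _ _).1
      _ ≤ C * ((min ε 1) ^ 2 / C) := mul_le_mul_of_nonneg_left (h4.trans (e1 ▸ h2)) C0.le
      _ = (min ε 1) ^ 2 := by field_simp
      _ ≤ ε ^ 2 := pow_le_pow_left₀ hm.le (min_le_left _ _) 2
  · intro σ hσ x hx h0
    refine ⟨fun t => ⟨σ t, (hW σ hσ x hx (h0 _) t).trans (h0 _)⟩, ?_⟩
    have hlim : Tendsto (fun t => C * l ^ (t / τ)) atTop (nhds 0) := by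
      have := ((tendsto_pow_atTop_nhds_zero_of_lt_one l0 l1).comp
        (Nat.tendsto_div_const_atTop (by omega : τ ≠ 0))).const_mul C
      simpa using this
    rw [tendsto_pi_nhds]
    intro q
    have hsq : Tendsto (fun t => x t q ^ 2) atTop (nhds 0) := by
      refine squeeze_zero (fun t => sq_nonneg _) (fun t => ?_) hlim
      calc x t q ^ 2 ≤ ∑ q, x t q ^ 2 :=
            Finset.single_le_sum (f := fun q => x t q ^ 2) (fun q _ => sq_nonneg _) (Finset.mem_univ q)
        _ ≤ C * qf (P (σ t)) (x t) := (hC _ _).1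
        _ ≤ C * l ^ (t / τ) := by
          refine mul_le_mul_of_nonneg_left ?_ C0.le
          exact (hd σ hσ x hx (h0 _) t).trans
            (mul_le_of_le_one_right (pow_nonneg l0 _) (h0 _))
    have := hsq.sqrt
    simp only [Real.sqrt_sq_eq_abs, Real.sqrt_zero] at this
    exact (tendsto_zero_iff_abs_tendsto_zero _).2 this
end

section
/- Consider the linear switched system x(t+1) = Ā_{σ(t)} x(t) with matrices Ā_i ∈ ℝ^{n×n}, i ∈ {1,…,N}. Suppose for some integer τ ≥ 1 there exist symmetric positive definite matrices P_i such that Ā_iᵀ P_i Ā_i − P_i is negative definite for all i, and (Ā_i^τ)ᵀ P_j Ā_i^τ − P_i is negative definite for all i ≠ j. Then the origin is globally asymptotically stable with dwell-time τ: for every ε > 0 there exists δ > 0 such that every trajectory under any DT-admissible switching signal with dwell-time τ starting with ‖x(0)‖ ≤ δ satisfies ‖x(t)‖ ≤ ε for all t, and every trajectory under any DT-admissible switching signal with dwell-time τ converges to 0 as t → ∞. -/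
open Matrix Filter

/-- A symmetric real matrix is negative definite. -/
def NegDefMat {n : ℕ} (M : Matrix (Fin n) (Fin n) ℝ) : Prop :=
  M.IsHermitian ∧ ∀ x : Fin n → ℝ, x ≠ 0 → x ⬝ᵥ M.mulVec x < 0


lemma aux_ratio {n : ℕ} (M K : Matrix (Fin n) (Fin n) ℝ)
    (hM : ∀ x : Fin n → ℝ, x ≠ 0 → 0 < x ⬝ᵥ M *ᵥ x) :
    ∃ C > (0 : ℝ), ∀ x : Fin n → ℝ, x ⬝ᵥ K *ᵥ x ≤ C * (x ⬝ᵥ M *ᵥ x) := by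
  have hc : ∀ L : Matrix (Fin n) (Fin n) ℝ, Continuous (fun x : Fin n → ℝ => x ⬝ᵥ L *ᵥ x) := by
    intro L
    exact Continuous.dotProduct continuous_id (Continuous.matrix_mulVec continuous_const continuous_id)
  have hcpt : IsCompact (Metric.sphere (0 : Fin n → ℝ) 1) := isCompact_sphere 0 1
  have hne : ∀ u ∈ Metric.sphere (0 : Fin n → ℝ) 1, u ≠ 0 := by
    rintro u hu rfl
    simp at hu
  have hcont : ContinuousOn (fun x : Fin n → ℝ => (x ⬝ᵥ K *ᵥ x) / (x ⬝ᵥ M *ᵥ x))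
      (Metric.sphere (0 : Fin n → ℝ) 1) :=
    (hc K).continuousOn.div (hc M).continuousOn (fun u hu => (hM u (hne u hu)).ne')
  obtain ⟨B, hB⟩ := hcpt.bddAbove_image hcont
  refine ⟨max B 1, by positivity, fun x => ?_⟩
  by_cases hx : x = 0
  · simp [hx]
  have hnx : 0 < ‖x‖ := norm_pos_iff.mpr hx
  set u : Fin n → ℝ := ‖x‖⁻¹ • x with hu
  have hus : u ∈ Metric.sphere (0 : Fin n → ℝ) 1 := by
    simp [hu, norm_smul, hnx.ne']
  have h1 := hB (Set.mem_image_of_mem _ hus)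
  have h2 := hM u (hne u hus)
  have h3 : u ⬝ᵥ K *ᵥ u ≤ max B 1 * (u ⬝ᵥ M *ᵥ u) := by
    rw [← div_le_iff₀ h2]
    exact h1.trans (le_max_left _ _)
  have hxu : x = ‖x‖ • u := by
    rw [hu, smul_smul, mul_inv_cancel₀ hnx.ne', one_smul]
  have hq : ∀ L : Matrix (Fin n) (Fin n) ℝ, x ⬝ᵥ L *ᵥ x = ‖x‖ ^ 2 * (u ⬝ᵥ L *ᵥ u) := by
    intro L
    conv_lhs => rw [hxu]
    rw [mulVec_smul, smul_dotProduct, dotProduct_smul]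
    simp only [smul_eq_mul]
    ring
  rw [hq K, hq M]
  nlinarith [mul_le_mul_of_nonneg_left h3 (sq_nonneg ‖x‖)]

lemma aux_unif {n : ℕ} {ι : Type*} [Fintype ι] (M K : ι → Matrix (Fin n) (Fin n) ℝ)
    (hM : ∀ i, ∀ x : Fin n → ℝ, x ≠ 0 → 0 < x ⬝ᵥ M i *ᵥ x) :
    ∃ C > (0 : ℝ), ∀ i, ∀ x : Fin n → ℝ, x ⬝ᵥ K i *ᵥ x ≤ C * (x ⬝ᵥ M i *ᵥ x) := by
  choose C hC h using fun i => aux_ratio (M i) (K i) (hM i)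
  have hs : 0 ≤ ∑ i, C i := Finset.sum_nonneg fun i _ => (hC i).le
  refine ⟨∑ i, C i + 1, by linarith, fun i x => (h i x).trans ?_⟩
  apply mul_le_mul_of_nonneg_right
  · have := Finset.single_le_sum (f := C) (fun i _ => (hC i).le) (Finset.mem_univ i)
    linarith
  · by_cases hx : x = 0
    · simp [hx]
    · exact (hM i x hx).le

lemma aux_back {N : ℕ} {τ : ℕ} {σ : ℕ → Fin N} (h : DTAdmissible τ σ) {t : ℕ}
    (ht : σ (t + 1) ≠ σ t) : ∀ r, r < τ → r ≤ t ∧ σ (t - r) = σ t := by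
  intro r
  induction r with
  | zero => intro _; simp
  | succ r ih =>
    intro hr
    obtain ⟨h1, h2⟩ := ih (by omega)
    have hrt : r ≠ t := by
      rintro rfl
      exact ht ((h.1 _ hr).trans (h.1 _ (by omega)).symm)
    refine ⟨by omega, ?_⟩
    by_contra hne
    obtain ⟨s, hs⟩ : ∃ s, t = s + 1 + r := ⟨t - r - 1, by omega⟩
    subst hs
    have e1 : s + 1 + r - (r + 1) = s := by omega
    have e2 : s + 1 + r - r = s + 1 := by omega
    rw [e1] at hne
    rw [e2] at h2
    have h3 := h.2 s (by rw [h2]; exact fun h => hne h.symm) (r + 1) hr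
    apply ht
    rw [← h2, ← h3]
    rfl

lemma aux_quad {n : ℕ} (A Q R : Matrix (Fin n) (Fin n) ℝ) (x : Fin n → ℝ) :
    x ⬝ᵥ (Aᵀ * Q * A - R) *ᵥ x = (A *ᵥ x) ⬝ᵥ Q *ᵥ (A *ᵥ x) - x ⬝ᵥ R *ᵥ x := by
  rw [sub_mulVec, dotProduct_sub, ← mulVec_mulVec, ← mulVec_mulVec, dotProduct_mulVec x,
    vecMul_transpose]

lemma aux_main {n N : ℕ} (Abar : Fin N → Matrix (Fin n) (Fin n) ℝ)
    (τ : ℕ) (hτ : 1 ≤ τ)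
    (P : Fin N → Matrix (Fin n) (Fin n) ℝ) (hP : ∀ i, (P i).PosDef)
    (h1 : ∀ i : Fin N, NegDefMat ((Abar i)ᵀ * P i * Abar i - P i))
    (h2 : ∀ i j : Fin N, i ≠ j → NegDefMat ((Abar i ^ τ)ᵀ * P j * Abar i ^ τ - P i)) :
    ∃ D > (0 : ℝ), ∃ μ : ℝ, 0 < μ ∧ μ < 1 ∧ ∀ σ : ℕ → Fin N, DTAdmissible τ σ →
      ∀ x : ℕ → Fin n → ℝ, Traj (fun i y => (Abar i).mulVec y) σ x →
        ∀ t, ∑ i, x t i ^ 2 ≤ D * μ ^ t * ∑ i, x 0 i ^ 2 := by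
  have hPp : ∀ i, ∀ x : Fin n → ℝ, x ≠ 0 → 0 < x ⬝ᵥ P i *ᵥ x := by
    intro i x hx
    simpa using (hP i).dotProduct_mulVec_pos hx
  have hPn : ∀ i, ∀ x : Fin n → ℝ, 0 ≤ x ⬝ᵥ P i *ᵥ x := by
    intro i x
    by_cases hx : x = 0
    · simp [hx]
    · exact (hPp i x hx).le
  have hsq : ∀ x : Fin n → ℝ, x ⬝ᵥ (1 : Matrix (Fin n) (Fin n) ℝ) *ᵥ x = ∑ i, x i ^ 2 := by
    intro x
    simp [dotProduct, sq]
  obtain ⟨C1, hC1, k1⟩ := aux_unif (fun i => P i - (Abar i)ᵀ * P i * Abar i) P (by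
    intro i x hx
    have := (h1 i).2 x hx
    rw [← neg_sub, neg_mulVec, dotProduct_neg]
    linarith)
  obtain ⟨C2, hC2, k2⟩ := aux_unif (ι := {p : Fin N × Fin N // p.1 ≠ p.2})
    (fun p => P p.1.1 - (Abar p.1.1 ^ τ)ᵀ * P p.1.2 * Abar p.1.1 ^ τ) (fun p => P p.1.1) (by
    intro p x hx
    have := (h2 p.1.1 p.1.2 p.2).2 x hx
    rw [← neg_sub, neg_mulVec, dotProduct_neg]
    linarith)
  obtain ⟨C3, hC3, k3⟩ := aux_unif P (fun _ => 1) hPp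
  obtain ⟨C4, hC4, k4⟩ := aux_unif (ι := Fin N) (fun _ => 1) P (by
    intro i x hx
    have := hPp i x hx
    simpa using (Matrix.PosDef.one (n := Fin n) (R := ℝ)).dotProduct_mulVec_pos hx)
  have key : ∀ C > (0:ℝ), ∀ a b : ℝ, 0 ≤ a → a ≤ C * (a - b) → b ≤ (1 - 1 / (C1 + C2 + 1)) * a ∨ C1 + C2 + 1 < C := by
    intro C hC a b ha hab
    by_cases hlt : C1 + C2 + 1 < C
    · exact Or.inr hlt
    left
    push Not at hlt
    have e1 : 1 / (C1 + C2 + 1) ≤ 1 / C := one_div_le_one_div_of_le hC hlt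
    have e2 : a / C ≤ a - b := by rw [div_le_iff₀ hC]; linarith
    have e3 := mul_le_mul_of_nonneg_right e1 ha
    have e4 : 1 / C * a = a / C := by ring
    linarith
  set lam : ℝ := 1 - 1 / (C1 + C2 + 1) with hlam
  have hl1 : lam < 1 := by
    have : 0 < 1 / (C1 + C2 + 1) := by positivity
    linarith
  have hl0 : 0 < lam := by
    have : 1 / (C1 + C2 + 1) < 1 := by rw [div_lt_one (by positivity)]; linarith
    linarith
  have d1 : ∀ i (x : Fin n → ℝ),
      (Abar i *ᵥ x) ⬝ᵥ P i *ᵥ (Abar i *ᵥ x) ≤ lam * (x ⬝ᵥ P i *ᵥ x) := by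
    intro i x
    have h := k1 i x
    rw [← neg_sub, neg_mulVec, dotProduct_neg, aux_quad, neg_sub] at h
    rcases key C1 hC1 _ _ (hPn i x) h with h | h
    · exact h
    · linarith
  have d2 : ∀ i j, i ≠ j → ∀ (x : Fin n → ℝ),
      ((Abar i ^ τ) *ᵥ x) ⬝ᵥ P j *ᵥ ((Abar i ^ τ) *ᵥ x) ≤ lam * (x ⬝ᵥ P i *ᵥ x) := by
    intro i j hij x
    have h := k2 ⟨(i, j), hij⟩ x
    rw [← neg_sub, neg_mulVec, dotProduct_neg, aux_quad, neg_sub] at h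
    rcases key C2 hC2 _ _ (hPn i x) h with h | h
    · exact h
    · linarith
  have hτ0 : τ ≠ 0 := by omega
  obtain ⟨μ, hμ0, hμτ⟩ : ∃ μ : ℝ, 0 < μ ∧ μ ^ τ = lam :=
    ⟨lam ^ ((τ : ℝ)⁻¹), Real.rpow_pos_of_pos hl0 _, Real.rpow_inv_natCast_pow hl0.le hτ0⟩
  have hμ1 : μ < 1 := by
    by_contra hge
    push Not at hge
    have := one_le_pow₀ hge (n := τ)
    linarith
  have hlμ : lam ≤ μ := by
    rw [← hμτ]
    exact pow_le_of_le_one hμ0.le hμ1.le hτ0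
  refine ⟨C3 * C4, by positivity, μ, hμ0, hμ1, fun σ hσ x hx t => ?_⟩
  have hW : ∀ t, x t ⬝ᵥ P (σ t) *ᵥ x t ≤ μ ^ t * (x 0 ⬝ᵥ P (σ 0) *ᵥ x 0) := by
    intro t
    induction t using Nat.strong_induction_on with
    | _ t ih =>
      rcases t with _ | t
      · simp
      by_cases hs : σ (t + 1) = σ t
      · have e := d1 (σ t) (x t)
        rw [hs, hx t]
        have e2 := ih t (by omega)
        have e3 := mul_le_mul hlμ e2 (hPn _ _) hμ0.le
        calc _ ≤ _ := e
          _ ≤ _ := e3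
          _ = _ := by ring
      · have hb := aux_back hσ hs
        obtain ⟨s, hts⟩ : ∃ s, t + 1 = s + τ := by
          have := (hb (τ - 1) (by omega)).1
          exact ⟨t + 1 - τ, by omega⟩
        have hσs : ∀ r < τ, σ (s + r) = σ t := by
          intro r hr
          have := (hb (t - (s + r)) (by omega)).2
          rwa [show t - (t - (s + r)) = s + r by omega] at this
        have hpow : ∀ r ≤ τ, x (s + r) = (Abar (σ t) ^ r) *ᵥ x s := by
          intro r
          induction r with
          | zero => simp
          | succ r ihr =>
            intro hr
            rw [← add_assoc, hx (s + r), ihr (by omega), hσs r (by omega), pow_succ', ← mulVec_mulVec]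
        have e := d2 (σ t) (σ (t + 1)) (fun h => hs h.symm) (x s)
        rw [← hpow τ le_rfl, ← hts] at e
        have e2 := ih s (by omega)
        have h0 := hσs 0 (by omega)
        rw [add_zero] at h0
        rw [h0] at e2
        calc _ ≤ _ := e
          _ ≤ _ := mul_le_mul_of_nonneg_left e2 hl0.le
          _ = _ := by rw [hts, pow_add, hμτ]; ring
  have f1 := k3 (σ t) (x t)
  have f2 := k4 (σ 0) (x 0)
  simp only [hsq] at f1 f2
  have hp : 0 ≤ μ ^ t := by positivity
  calc _ ≤ _ := f1
    _ ≤ C3 * (μ ^ t * (C4 * ∑ i, x 0 i ^ 2)) :=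
      mul_le_mul_of_nonneg_left ((hW t).trans (mul_le_mul_of_nonneg_left f2 hp)) hC3.le
    _ = _ := by ring

/-- MLF stability criterion for the unsaturated linear switched system
`x(t+1) = Ā_{σ(t)} x(t)` under dwell-time `τ` switching. -/
theorem stmt11 {n N : ℕ} (Abar : Fin N → Matrix (Fin n) (Fin n) ℝ)
    (τ : ℕ) (hτ : 1 ≤ τ)
    (P : Fin N → Matrix (Fin n) (Fin n) ℝ) (hP : ∀ i, (P i).PosDef)
    (h1 : ∀ i : Fin N, NegDefMat ((Abar i)ᵀ * P i * Abar i - P i))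
    (h2 : ∀ i j : Fin N, i ≠ j → NegDefMat ((Abar i ^ τ)ᵀ * P j * Abar i ^ τ - P i)) :
    (∀ ε > (0 : ℝ), ∃ δ > (0 : ℝ), ∀ σ : ℕ → Fin N, DTAdmissible τ σ →
      ∀ x : ℕ → Fin n → ℝ, Traj (fun i y => (Abar i).mulVec y) σ x →
        euclNorm (x 0) ≤ δ → ∀ t, euclNorm (x t) ≤ ε) ∧
    (∀ σ : ℕ → Fin N, DTAdmissible τ σ → ∀ x : ℕ → Fin n → ℝ,
      Traj (fun i y => (Abar i).mulVec y) σ x → Tendsto x atTop (nhds 0)) := by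
  obtain ⟨D, hD, μ, hμ0, hμ1, H⟩ := aux_main Abar τ hτ P hP h1 h2
  constructor
  · intro ε hε
    have hsD : 0 < Real.sqrt D := Real.sqrt_pos.mpr hD
    refine ⟨ε / Real.sqrt D, by positivity, fun σ hσ x hx h0 t => ?_⟩
    have h := H σ hσ x hx t
    have hS : 0 ≤ ∑ i, x 0 i ^ 2 := Finset.sum_nonneg fun i _ => sq_nonneg _
    have hle : ∑ i, x t i ^ 2 ≤ D * ∑ i, x 0 i ^ 2 := by
      refine h.trans (mul_le_mul_of_nonneg_right ?_ hS)
      exact mul_le_of_le_one_right hD.le (pow_le_one₀ hμ0.le hμ1.le)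
    unfold euclNorm at h0 ⊢
    calc _ ≤ _ := Real.sqrt_le_sqrt hle
      _ = Real.sqrt D * Real.sqrt (∑ i, x 0 i ^ 2) := Real.sqrt_mul hD.le _
      _ ≤ Real.sqrt D * (ε / Real.sqrt D) := mul_le_mul_of_nonneg_left h0 hsD.le
      _ = ε := by field_simp
  · intro σ hσ x hx
    have h := H σ hσ x hx
    rw [tendsto_pi_nhds]
    intro i
    have hlim : Tendsto (fun t : ℕ => D * μ ^ t * ∑ i, x 0 i ^ 2) atTop (nhds 0) := by
      have := ((tendsto_pow_atTop_nhds_zero_of_lt_one hμ0.le hμ1).const_mul D).mul_const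
        (∑ i, x 0 i ^ 2)
      simpa using this
    have hsq : Tendsto (fun t => x t i ^ 2) atTop (nhds 0) := by
      refine squeeze_zero (fun t => sq_nonneg _) (fun t => ?_) hlim
      exact (Finset.single_le_sum (f := fun i => x t i ^ 2) (fun i _ => sq_nonneg _)
        (Finset.mem_univ i)).trans (h t)
    have h3 := hsq.sqrt
    simp only [Real.sqrt_sq_eq_abs, Real.sqrt_zero] at h3
    exact (tendsto_zero_iff_abs_tendsto_zero _).mpr h3
end

section
/- Let P ∈ ℝ^{n×n} be symmetric positive definite and let h ∈ ℝ^n be a row vector (viewed as a linear functional x ↦ h·x). Then the ellipsoid E(P) = {x : xᵀPx ≤ 1} is contained in the slab {x : |h·x| ≤ 1} if and only if h P^{−1} hᵀ ≤ 1. -/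
open Matrix

/-- Ellipsoid–slab inclusion: `E(P) ⊆ {x : |h·x| ≤ 1}` iff `h P⁻¹ hᵀ ≤ 1`. -/
theorem stmt12 {n : ℕ} (P : Matrix (Fin n) (Fin n) ℝ) (hP : P.PosDef)
    (h : Fin n → ℝ) :
    {x : Fin n → ℝ | x ⬝ᵥ P.mulVec x ≤ 1} ⊆ {x : Fin n → ℝ | |h ⬝ᵥ x| ≤ 1} ↔
      h ⬝ᵥ P⁻¹.mulVec h ≤ 1 := by
  have hdet : IsUnit P.det := (Matrix.isUnit_iff_isUnit_det P).1 hP.isUnit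
  obtain ⟨y, hy⟩ : ∃ y, y = P⁻¹.mulVec h := ⟨_, rfl⟩
  have hPy : P.mulVec y = h := by
    rw [hy, Matrix.mulVec_mulVec, Matrix.mul_nonsing_inv _ hdet, Matrix.one_mulVec]
  rw [← hy]
  have hT : Pᵀ = P := by
    have := hP.isHermitian
    rwa [Matrix.IsHermitian, Matrix.conjTranspose_eq_transpose_of_trivial] at this
  have hyx : ∀ x, y ⬝ᵥ P.mulVec x = h ⬝ᵥ x := by
    intro x
    rw [Matrix.dotProduct_mulVec, ← Matrix.mulVec_transpose, hT, hPy]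
  constructor
  · intro H
    by_contra hc
    push Not at hc
    have hs : 0 < √(h ⬝ᵥ y) := Real.sqrt_pos.2 (by linarith)
    have hsq : √(h ⬝ᵥ y) * √(h ⬝ᵥ y) = h ⬝ᵥ y := Real.mul_self_sqrt (by linarith)
    have h1 : (√(h ⬝ᵥ y))⁻¹ * (h ⬝ᵥ y) = √(h ⬝ᵥ y) := by
      rw [inv_mul_eq_iff_eq_mul₀ hs.ne']; exact hsq.symm
    have := @H ((√(h ⬝ᵥ y))⁻¹ • y) (by
      simp only [Set.mem_setOf_eq, Matrix.mulVec_smul, smul_dotProduct, dotProduct_smul,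
        smul_eq_mul, hyx]
      rw [h1, inv_mul_cancel₀ hs.ne'])
    simp only [Set.mem_setOf_eq, dotProduct_smul, smul_eq_mul, h1] at this
    have h2 := (abs_le.1 this).2
    nlinarith
  · intro hc x hx
    simp only [Set.mem_setOf_eq] at hx ⊢
    have key : ∀ t : ℝ, 0 ≤ x ⬝ᵥ P.mulVec x - 2 * t * (h ⬝ᵥ x) + t ^ 2 * (h ⬝ᵥ y) := by
      intro t
      have h0 := hP.posSemidef.dotProduct_mulVec_nonneg (x - t • y)
      simp only [star_trivial, Matrix.mulVec_sub, Matrix.mulVec_smul, sub_dotProduct,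
        dotProduct_sub, smul_dotProduct, dotProduct_smul, smul_eq_mul, hyx, hPy,
        dotProduct_comm x h, dotProduct_comm y h] at h0
      linarith
    have k1 := key 1
    have k2 := key (-1)
    rw [abs_le]
    constructor <;> linarith
end

section
/- Let P_i, P_j ∈ ℝ^{n×n} be symmetric positive definite with inverses Q_i = P_i^{−1}, Q_j = P_j^{−1}, and let M ∈ ℝ^{n×n}. Then Mᵀ P_j M − P_i is negative definite if and only if the 2n×2n block matrix [[Q_i, (M Q_i)ᵀ], [M Q_i, Q_j]] is positive definite. -/
open Matrix

/-- Schur-complement equivalence: with `Q_i = P_i⁻¹`, `Q_j = P_j⁻¹`,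
`Mᵀ P_j M − P_i ≺ 0` iff `[[Q_i, (M Q_i)ᵀ], [M Q_i, Q_j]] ≻ 0`. -/
theorem stmt13 {n : ℕ} (Pi Pj : Matrix (Fin n) (Fin n) ℝ)
    (hPi : Pi.PosDef) (hPj : Pj.PosDef) (M : Matrix (Fin n) (Fin n) ℝ) :
    NegDefMat (Mᵀ * Pj * M - Pi) ↔
      (Matrix.fromBlocks Pi⁻¹ (M * Pi⁻¹)ᵀ (M * Pi⁻¹) Pj⁻¹).PosDef := by
  have hsi : Piᵀ = Pi := by simpa using hPi.isHermitian.eq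
  have hsj : Pjᵀ = Pj := by simpa using hPj.isHermitian.eq
  have hui : IsUnit Pi.det := (Matrix.isUnit_iff_isUnit_det _).1 hPi.isUnit
  have huj : IsUnit Pj.det := (Matrix.isUnit_iff_isUnit_det _).1 hPj.isUnit
  have hH : (Mᵀ * Pj * M - Pi).IsHermitian := by
    simp [Matrix.IsHermitian, conjTranspose_eq_transpose_of_trivial, hsi, hsj, Matrix.mul_assoc]
  have hBH : (Matrix.fromBlocks Pi⁻¹ (M * Pi⁻¹)ᵀ (M * Pi⁻¹) Pj⁻¹).IsHermitian := by
    rw [Matrix.isHermitian_fromBlocks_iff]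
    exact ⟨hPi.inv.isHermitian, by simp [conjTranspose_eq_transpose_of_trivial],
      by simp [conjTranspose_eq_transpose_of_trivial], hPj.inv.isHermitian⟩
  have key : ∀ z y : Fin n → ℝ,
      (Sum.elim (Pi *ᵥ z) y) ⬝ᵥ
        ((Matrix.fromBlocks Pi⁻¹ (M * Pi⁻¹)ᵀ (M * Pi⁻¹) Pj⁻¹) *ᵥ (Sum.elim (Pi *ᵥ z) y))
      = (Pj *ᵥ (M *ᵥ z) + y) ⬝ᵥ (Pj⁻¹ *ᵥ (Pj *ᵥ (M *ᵥ z) + y))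
        - z ⬝ᵥ ((Mᵀ * Pj * M - Pi) *ᵥ z) := by
    intro z y
    have h1 : Pi⁻¹ *ᵥ (Pi *ᵥ z) = z := by
      rw [mulVec_mulVec, Matrix.nonsing_inv_mul _ hui, one_mulVec]
    have h2 : ∀ w, Pj⁻¹ *ᵥ (Pj *ᵥ w) = w := fun w => by
      rw [mulVec_mulVec, Matrix.nonsing_inv_mul _ huj, one_mulVec]
    have h3 : ∀ w, (Pi *ᵥ z) ⬝ᵥ ((M * Pi⁻¹)ᵀ *ᵥ w) = (M *ᵥ z) ⬝ᵥ w := fun w => by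
      rw [dotProduct_mulVec, vecMul_transpose, ← mulVec_mulVec, h1]
    have h4 : ∀ w, (Pj *ᵥ w) ⬝ᵥ (Pj⁻¹ *ᵥ y) = w ⬝ᵥ y := fun w => by
      rw [← vecMul_transpose, hsj, ← dotProduct_mulVec, mulVec_mulVec,
        Matrix.mul_nonsing_inv _ huj, one_mulVec]
    have h5 : z ⬝ᵥ ((Mᵀ * Pj * M) *ᵥ z) = (Pj *ᵥ (M *ᵥ z)) ⬝ᵥ (M *ᵥ z) := by
      rw [Matrix.mul_assoc, ← mulVec_mulVec, dotProduct_mulVec, vecMul_transpose,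
        ← mulVec_mulVec, dotProduct_comm]
    rw [fromBlocks_mulVec, sumElim_dotProduct_sumElim]
    simp only [Sum.elim_comp_inl, Sum.elim_comp_inr, mulVec_add, dotProduct_add, add_dotProduct,
      sub_mulVec, dotProduct_sub, h1, h2, h3, h4, h5, ← mulVec_mulVec]
    rw [dotProduct_comm (Pi *ᵥ z) z]
    have h6 : z ⬝ᵥ (Mᵀ *ᵥ (Pj *ᵥ (M *ᵥ z))) = (Pj *ᵥ (M *ᵥ z)) ⬝ᵥ (M *ᵥ z) := by
      rw [← h5]; simp [mulVec_mulVec, Matrix.mul_assoc]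
    rw [h6]
    ring
  constructor
  · rintro ⟨-, h⟩
    refine .of_dotProduct_mulVec_pos hBH fun v hv => ?_
    obtain ⟨z, y, rfl⟩ : ∃ z y, v = Sum.elim (Pi *ᵥ z) y := by
      refine ⟨Pi⁻¹ *ᵥ (v ∘ Sum.inl), v ∘ Sum.inr, ?_⟩
      rw [mulVec_mulVec, Matrix.mul_nonsing_inv _ hui, one_mulVec, Sum.elim_comp_inl_inr]
    rw [star_trivial, key]
    by_cases hz : z = 0
    · subst hz
      have hy : y ≠ 0 := by
        rintro rfl
        apply hv
        ext i
        cases i <;> simp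
      simpa using hPj.inv.dotProduct_mulVec_pos hy
    · have h1 := h z hz
      have h2 := hPj.inv.posSemidef.dotProduct_mulVec_nonneg (Pj *ᵥ (M *ᵥ z) + y)
      rw [star_trivial] at h2
      linarith
  · intro h
    refine ⟨hH, fun z hz => ?_⟩
    have hne : Sum.elim (Pi *ᵥ z) (-(Pj *ᵥ (M *ᵥ z))) ≠ 0 := by
      intro h0
      apply hz
      have : Pi *ᵥ z = 0 := by
        ext i
        simpa using congrFun h0 (Sum.inl i)
      rw [← one_mulVec z, ← Matrix.nonsing_inv_mul _ hui, ← mulVec_mulVec, this, mulVec_zero]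
    have h1 := h.dotProduct_mulVec_pos hne
    rw [star_trivial, key] at h1
    simp only [add_neg_cancel, zero_dotProduct] at h1
    linarith
end
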